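/- arXiv:math/0404419 — 3 statements merged into one kernel-verified Lean document; each statement's English description precedes it below -/
import Mathlib

section
/- For every field k and all integers n, a, b, c, the set of Hilbert series {A(z) : A ∈ D(n,a,b,c)} is finite; that is, there are only finitely many formal power series arising as Hilbert series of connected locally finite graded k-algebras with at most n generators, generators in degrees ≤ a, relations in degrees ≤ b, and third homology (degrees of relations among the relations) bounded by c. -/
open MulOpposite

namespace NCG

variable (k : Type) [Field k] (R : Type) [Ring R] [Algebra k R]

/-- `𝒜` is a connected grading on the `k`-algebra `R`: the graded pieces multiply
correctly, `R` is their internal direct sum, and the degree-zero piece is `k·1`. -/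
def IsConnAlg (𝒜 : ℕ → Submodule k R) : Prop :=
  (∀ (i j : ℕ), ∀ x ∈ 𝒜 i, ∀ y ∈ 𝒜 j, x * y ∈ 𝒜 (i + j)) ∧
  DirectSum.IsInternal 𝒜 ∧
  𝒜 0 = Submodule.span k {(1 : R)}

/-- `R` is locally finite: every graded piece is finite-dimensional over `k`. -/
def LocFin (𝒜 : ℕ → Submodule k R) : Prop := ∀ i, FiniteDimensional k (𝒜 i)

/-- `R` is a finitely generated `k`-algebra. -/
def FinGenAlg : Prop := ∃ s : Finset R, Algebra.adjoin k (s : Set R) = ⊤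

/-- extension of the grading to `ℤ` (zero in negative degrees). -/
noncomputable def grZ (𝒜 : ℕ → Submodule k R) : ℤ → Submodule k R :=
  fun j => if 0 ≤ j then 𝒜 j.toNat else ⊥

/-- the augmentation ideal `R_{≥1}`, as a right ideal of `R`. -/
def aug (𝒜 : ℕ → Submodule k R) : Submodule Rᵐᵒᵖ R :=
  Submodule.span Rᵐᵒᵖ (⋃ i : ℕ, ⋃ _ : 1 ≤ i, ((𝒜 i : Set R)))

variable (M : Type) [AddCommGroup M] [Module Rᵐᵒᵖ M] [Module k M]

/-- `ℳ` makes `M` a graded right module over the graded algebra `(R, 𝒜)`. -/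
def IsGradedMod (𝒜 : ℕ → Submodule k R) (ℳ : ℤ → Submodule k M) : Prop :=
  (∀ (i : ℕ) (j : ℤ), ∀ r ∈ 𝒜 i, ∀ x ∈ ℳ j, (op r) • x ∈ ℳ (j + i)) ∧
  DirectSum.IsInternal ℳ

/-- the submodule `N` of `M` is generated in degrees at most `dd`. -/
def GenLE (ℳ : ℤ → Submodule k M) (N : Submodule Rᵐᵒᵖ M) (dd : ℤ) : Prop :=
  N ≤ Submodule.span Rᵐᵒᵖ {x : M | x ∈ N ∧ ∃ j ≤ dd, x ∈ ℳ j}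

/-- the submodule `N` is a graded (homogeneous) submodule of `M`. -/
def IsGradedSub (ℳ : ℤ → Submodule k M) (N : Submodule Rᵐᵒᵖ M) : Prop :=
  N ≤ Submodule.span Rᵐᵒᵖ {x : M | x ∈ N ∧ ∃ j : ℤ, x ∈ ℳ j}

/-- the Hilbert series of a submodule `N` of `M`, as its coefficient function. -/
noncomputable def hilb (ℳ : ℤ → Submodule k M) [IsScalarTower k Rᵐᵒᵖ M]
    (N : Submodule Rᵐᵒᵖ M) : ℤ → ℕ :=
  fun j => Module.finrank k ↥(ℳ j ⊓ N.restrictScalars k)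

/-- the Hilbert series of a right ideal of `R`, as its coefficient function. -/
noncomputable def hilbI (𝒜 : ℕ → Submodule k R) (I : Submodule Rᵐᵒᵖ R) : ℕ → ℕ :=
  fun j => Module.finrank k ↥(𝒜 j ⊓ I.restrictScalars k)

/-- the Hilbert series of the algebra `R`, as its coefficient function. -/
noncomputable def hilbA (𝒜 : ℕ → Submodule k R) : ℕ → ℕ :=
  fun j => Module.finrank k ↥(𝒜 j)

/-- `v` is a solution of the homogeneous linear equation `a₁x₁ + ⋯ + aₙxₙ = 0`. -/
def IsSol {n : ℕ} (a : Fin n → M) (v : Fin n → R) : Prop :=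
  ∑ i, op (v i) • a i = 0

/-- `w` is a homogeneous element of degree `j` of the free module `⊕ᵢ R(-dg i)`. -/
def FreeHomog (𝒜 : ℕ → Submodule k R) {n : ℕ} (dg : Fin n → ℤ)
    (w : Fin n → R) (j : ℤ) : Prop :=
  ∀ i, w i ∈ grZ k R 𝒜 (j - dg i)

/-- The module of solutions of the equation with homogeneous coefficients `a` (of
degrees `dg`) is generated in degrees at most `D`: every solution is an `R`-linear
combination of homogeneous solutions of degree at most `D`. -/
def SolGenLE (𝒜 : ℕ → Submodule k R) {n : ℕ} (a : Fin n → M) (dg : Fin n → ℤ)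
    (D : ℤ) : Prop :=
  ∀ v : Fin n → R, IsSol R M a v →
    v ∈ Submodule.span Rᵐᵒᵖ
      {w : Fin n → R | IsSol R M a w ∧ ∃ j ≤ D, FreeHomog k R 𝒜 dg w j}

/-- The module of solutions of the equation with coefficients `a` is generated by the
(finitely many) solutions `h`. -/
def SolSpanBy {n : ℕ} (a : Fin n → M) {m : ℕ} (h : Fin m → (Fin n → R)) : Prop :=
  (∀ j, IsSol R M a (h j)) ∧
  ∀ v : Fin n → R, IsSol R M a v → v ∈ Submodule.span Rᵐᵒᵖ (Set.range h)

/-- `D` witnesses the effective coherence of the graded module `M`. -/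
def WitnessEC (𝒜 : ℕ → Submodule k R) (ℳ : ℤ → Submodule k M) (D : ℕ → ℕ) : Prop :=
  (∀ d, d ≤ D d) ∧
  ∀ (d n : ℕ) (a : Fin n → M) (dg : Fin n → ℤ),
    (∀ i, a i ∈ ℳ (dg i)) → (∀ i, dg i ≤ (d : ℤ)) →
    SolGenLE k R M 𝒜 a dg ((D d : ℕ) : ℤ)

/-- the graded module `M` is effectively coherent. -/
def EffCoh (𝒜 : ℕ → Submodule k R) (ℳ : ℤ → Submodule k M) : Prop :=
  ∃ D : ℕ → ℕ, WitnessEC k R M 𝒜 ℳ D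

/-- the algebra `R` is effectively coherent (as a right module over itself). -/
noncomputable def EffCohAlg (𝒜 : ℕ → Submodule k R) : Prop :=
  EffCoh k R R 𝒜 (grZ k R 𝒜)

/-- `M` is a finitely presented graded right `R`-module. -/
def ModFinPres (𝒜 : ℕ → Submodule k R) (ℳ : ℤ → Submodule k M) : Prop :=
  ∃ (t : ℕ) (b : Fin t → M) (db : Fin t → ℤ),
    (∀ i, b i ∈ ℳ (db i)) ∧ Submodule.span Rᵐᵒᵖ (Set.range b) = ⊤ ∧
    ∃ (m : ℕ) (h : Fin m → (Fin t → R)) (e : Fin m → ℤ),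
      (∀ j, FreeHomog k R 𝒜 db (h j) (e j)) ∧ SolSpanBy R M b h

/-- `R` is a finitely presented algebra: there is an exact sequence
`F₂ → F₁ → R → k_R → 0` of graded right modules with `F₁, F₂` finite graded free. -/
def AlgFinPres (𝒜 : ℕ → Submodule k R) : Prop :=
  ∃ (n : ℕ) (g : Fin n → R) (dg : Fin n → ℕ),
    (∀ i, g i ∈ 𝒜 (dg i)) ∧
    Submodule.span Rᵐᵒᵖ (Set.range g) = aug k R 𝒜 ∧
    ∃ (m : ℕ) (h : Fin m → (Fin n → R)) (e : Fin m → ℤ),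
      (∀ j, FreeHomog k R 𝒜 (fun i => (dg i : ℤ)) (h j) (e j)) ∧
      SolSpanBy R R g h

/-- `R` admits an exact sequence `F₃ → F₂ → F₁ → R → k_R → 0` of graded right modules
with all `Fᵢ` finite graded free (finitely presented with `dim Tor₃ < ∞`). -/
def AlgFinPres3 (𝒜 : ℕ → Submodule k R) : Prop :=
  ∃ (n : ℕ) (g : Fin n → R) (dg : Fin n → ℕ),
    (∀ i, g i ∈ 𝒜 (dg i)) ∧
    Submodule.span Rᵐᵒᵖ (Set.range g) = aug k R 𝒜 ∧
    ∃ (m : ℕ) (h : Fin m → (Fin n → R)) (e : Fin m → ℤ),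
      (∀ j, FreeHomog k R 𝒜 (fun i => (dg i : ℤ)) (h j) (e j)) ∧
      SolSpanBy R R g h ∧
      ∃ (p : ℕ) (u : Fin p → (Fin m → R)) (f : Fin p → ℤ),
        (∀ l, FreeHomog k R 𝒜 e (u l) (f l)) ∧
        SolSpanBy R (Fin n → R) h u

/-- membership in the class `D(n,a,b,c)`: there is an exact sequence
`F₃ → F₂ → F₁ → R → k_R → 0` with `F₁` of rank at most `n` and basis in degrees `≤ a`,
`F₂` with basis in degrees `≤ b` and `F₃` with basis in degrees `≤ c`. -/
def InDClass (𝒜 : ℕ → Submodule k R) (n a b c : ℕ) : Prop :=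
  ∃ (n' : ℕ), n' ≤ n ∧ ∃ (g : Fin n' → R) (dg : Fin n' → ℕ),
    (∀ i, dg i ≤ a) ∧ (∀ i, g i ∈ 𝒜 (dg i)) ∧
    Submodule.span Rᵐᵒᵖ (Set.range g) = aug k R 𝒜 ∧
    ∃ (m : ℕ) (h : Fin m → (Fin n' → R)) (e : Fin m → ℤ),
      (∀ j, e j ≤ (b : ℤ)) ∧
      (∀ j, FreeHomog k R 𝒜 (fun i => (dg i : ℤ)) (h j) (e j)) ∧
      SolSpanBy R R g h ∧
      SolGenLE k R (Fin n' → R) 𝒜 h e (c : ℤ)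

/-- the right ideal `I` has a finite homogeneous generating family in degrees `≤ d`. -/
def FinGenLE (𝒜 : ℕ → Submodule k R) (I : Submodule Rᵐᵒᵖ R) (d : ℕ) : Prop :=
  ∃ (n : ℕ) (x : Fin n → R) (dx : Fin n → ℕ),
    (∀ i, dx i ≤ d) ∧ (∀ i, x i ∈ 𝒜 (dx i)) ∧
    Submodule.span Rᵐᵒᵖ (Set.range x) = I

/-- lexicographic strict order on `ℕ`-indexed coefficient functions: `f <_lex g`. -/
def LexLtN (f g : ℕ → ℕ) : Prop := ∃ q, (∀ i < q, f i = g i) ∧ f q < g q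

/-- lexicographic strict order on `ℤ`-indexed coefficient functions: `f <_lex g`. -/
def LexLtZ (f g : ℤ → ℕ) : Prop := ∃ q, (∀ i < q, f i = g i) ∧ f q < g q

/-- the right annihilator ideal of an element `a : R`. -/
def rAnn (a : R) : Submodule Rᵐᵒᵖ R where
  carrier := {r : R | a * r = 0}
  add_mem' := by
    intro x y hx hy
    simp only [Set.mem_setOf_eq] at *
    rw [mul_add, hx, hy, add_zero]
  zero_mem' := by simp
  smul_mem' := by
    intro c x hx
    simp only [Set.mem_setOf_eq] at *
    rw [← op_unop c, op_smul_eq_mul, ← mul_assoc, hx, zero_mul]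

/-- the colon right ideal `(x : J) = { a ∈ R | x·a ∈ J }`. -/
def colon (x : R) (J : Submodule Rᵐᵒᵖ R) : Submodule Rᵐᵒᵖ R where
  carrier := {a : R | x * a ∈ J}
  add_mem' := by
    intro p q hp hq
    simp only [Set.mem_setOf_eq] at *
    rw [mul_add]; exact J.add_mem hp hq
  zero_mem' := by simp
  smul_mem' := by
    intro c p hp
    simp only [Set.mem_setOf_eq] at *
    rw [← op_unop c, op_smul_eq_mul, ← mul_assoc]
    exact J.smul_mem (op (unop c)) hp

/-- `F` is a coherent family of right ideals of `R`. -/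
def IsCohFam (𝒜 : ℕ → Submodule k R) (F : Set (Submodule Rᵐᵒᵖ R)) : Prop :=
  (∀ I ∈ F, I.FG ∧ IsGradedSub k R R (grZ k R 𝒜) I) ∧
  (⊥ : Submodule Rᵐᵒᵖ R) ∈ F ∧ aug k R 𝒜 ∈ F ∧
  ∀ I ∈ F, I ≠ ⊥ → ∃ J ∈ F, J ≠ I ∧ ∃ x : R, (∃ dx : ℕ, x ∈ 𝒜 dx) ∧ x ∈ I ∧
    I = J ⊔ Submodule.span Rᵐᵒᵖ {x} ∧
    (∀ dI : ℤ, GenLE k R R (grZ k R 𝒜) I dI → GenLE k R R (grZ k R 𝒜) J dI) ∧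
    colon R x J ∈ F

/-- the family `F` of ideals has degree at most `d`. -/
def CohFamDegLE (𝒜 : ℕ → Submodule k R) (F : Set (Submodule Rᵐᵒᵖ R)) (d : ℕ) : Prop :=
  ∀ I ∈ F, GenLE k R R (grZ k R 𝒜) I (d : ℤ)

/-- the right ideal `I` is finitely presented as a graded module. -/
def IdealFinPres (𝒜 : ℕ → Submodule k R) (I : Submodule Rᵐᵒᵖ R) : Prop :=
  ∃ (n : ℕ) (x : Fin n → R) (dx : Fin n → ℕ),
    (∀ i, x i ∈ 𝒜 (dx i)) ∧ Submodule.span Rᵐᵒᵖ (Set.range x) = I ∧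
    ∃ (m : ℕ) (h : Fin m → (Fin n → R)) (e : Fin m → ℤ),
      (∀ j, FreeHomog k R 𝒜 (fun i => (dx i : ℤ)) (h j) (e j)) ∧
      SolSpanBy R R x h

/-- `R` is graded right coherent: every finitely generated homogeneous right ideal
is finitely presented as a graded module. -/
def GradedCoherent (𝒜 : ℕ → Submodule k R) : Prop :=
  ∀ I : Submodule Rᵐᵒᵖ R, I.FG → IsGradedSub k R R (grZ k R 𝒜) I →
    IdealFinPres k R 𝒜 I

/-- a free resolution of the right ideal `I` by finite graded free modules whose
bases at level `i` sit in degrees at most `B i`. -/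
def FreeResBdd (𝒜 : ℕ → Submodule k R) (I : Submodule Rᵐᵒᵖ R) (B : ℕ → ℤ) : Prop :=
  ∃ (r : ℕ → ℕ) (dgs : (i : ℕ) → Fin (r i) → ℤ)
    (g0 : Fin (r 0) → R)
    (g : (i : ℕ) → Fin (r (i + 1)) → (Fin (r i) → R)),
    (∀ l, dgs 0 l ≤ B 0) ∧
    (∀ l, g0 l ∈ grZ k R 𝒜 (dgs 0 l)) ∧
    Submodule.span Rᵐᵒᵖ (Set.range g0) = I ∧
    (∀ (i : ℕ) (l : Fin (r (i + 1))), dgs (i + 1) l ≤ B (i + 1)) ∧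
    (∀ (i : ℕ) (l : Fin (r (i + 1))), FreeHomog k R 𝒜 (dgs i) (g i l) (dgs (i + 1) l)) ∧
    SolSpanBy R R g0 (g 0) ∧
    (∀ i : ℕ, SolSpanBy R (Fin (r i) → R) (g i) (g (i + 1)))

/-- the Artin–Zhang property for a graded module `M`. -/
def ArtinZhang (ℳ : ℤ → Submodule k M) [IsScalarTower k Rᵐᵒᵖ M] : Prop :=
  ∀ h : ℤ → ℕ, ∃ d : ℤ, 0 < d ∧
    (∀ L : Submodule Rᵐᵒᵖ M, L.FG → hilb k R M ℳ L = h → GenLE k R M ℳ L d) ∧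
    (∀ L : Submodule Rᵐᵒᵖ M, GenLE k R M ℳ L d →
      (∀ j ≤ d, hilb k R M ℳ L j = h j) → hilb k R M ℳ L = h)

/-- `M` is effective for series: for each `d`, only finitely many Hilbert series of
submodules generated in degrees `≤ d`. -/
def EffForSeries (ℳ : ℤ → Submodule k M) [IsScalarTower k Rᵐᵒᵖ M] : Prop :=
  ∀ d : ℤ, {h : ℤ → ℕ | ∃ L : Submodule Rᵐᵒᵖ M,
    GenLE k R M ℳ L d ∧ h = hilb k R M ℳ L}.Finite

/-- `M` is effective for generators: the Hilbert series of a finitely generated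
submodule bounds the degrees of its generators. -/
def EffForGen (ℳ : ℤ → Submodule k M) [IsScalarTower k Rᵐᵒᵖ M] : Prop :=
  ∀ h : ℤ → ℕ, ∃ d : ℤ,
    ∀ L : Submodule Rᵐᵒᵖ M, L.FG → hilb k R M ℳ L = h → GenLE k R M ℳ L d

/-- bundled data of a graded `k`-algebra. -/
structure AlgData (k : Type) [Field k] : Type 1 where
  carrier : Type
  [ringStr : Ring carrier]
  [algStr : Algebra k carrier]
  grading : ℕ → Submodule k carrier

attribute [instance] AlgData.ringStr AlgData.algStr

/-- bundled data of a graded right `R`-module. -/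
structure ModData (k R : Type) [Field k] [Ring R] [Algebra k R] : Type 1 where
  carrier : Type
  [acg : AddCommGroup carrier]
  [modR : Module Rᵐᵒᵖ carrier]
  [modk : Module k carrier]
  [tower : IsScalarTower k Rᵐᵒᵖ carrier]
  grading : ℤ → Submodule k carrier

attribute [instance] ModData.acg ModData.modR ModData.modk ModData.tower

end NCG

set_option linter.unusedSectionVars false

namespace NCGProof

open MulOpposite

section LinAlg

variable {W : Type} [Monoid W]

/-- coefficientwise base change on the monoid algebra. -/
noncomputable abbrev mp {O k : Type} [CommRing O] [CommRing k] (π : O →+* k) :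
    MonoidAlgebra O W →+* MonoidAlgebra k W := MonoidAlgebra.mapRingHom W π

lemma mp_coeff {O k : Type} [CommRing O] [CommRing k] (π : O →+* k) (x : MonoidAlgebra O W)
    (w : W) : (mp π x).coeff w = π (x.coeff w) := by
  simp [mp]

lemma mp_smul {O k : Type} [CommRing O] [CommRing k] (π : O →+* k) (c : O)
    (x : MonoidAlgebra O W) : mp π (c • x) = π c • mp π x := by
  ext w
  rw [mp_coeff]
  simp

lemma echelon {K : Type} [Field K] (N : Submodule K (MonoidAlgebra K W))
    [FiniteDimensional K N] :
    ∃ (r : ℕ) (t : Fin r → W) (y : Fin r → MonoidAlgebra K W),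
      r = Module.finrank K N ∧
      (∀ l, y l ∈ N) ∧ (∀ l l', (y l).coeff (t l') = if l = l' then 1 else 0) ∧
      (∀ x ∈ N, x = ∑ l, x.coeff (t l) • y l) := by
  classical
  let ev : W → Module.Dual K N := fun w =>
    { toFun := fun x => (x : MonoidAlgebra K W).coeff w
      map_add' := by intro x y; simp
      map_smul' := by intro x y; simp }
  have hev : ∀ w (x : N), ev w x = (x : MonoidAlgebra K W).coeff w := fun w x => rfl
  have htop : Submodule.span K (Set.range ev) = ⊤ := by
    have h1 : (Submodule.span K (Set.range ev)).dualCoannihilator = ⊥ := by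
      rw [eq_bot_iff]
      intro x hx
      rw [Submodule.mem_dualCoannihilator] at hx
      rw [Submodule.mem_bot]
      apply Subtype.ext
      ext w
      have := hx (ev w) (Submodule.subset_span ⟨w, rfl⟩)
      simpa [hev] using this
    rw [← Subspace.dualCoannihilator_dualAnnihilator_eq (W := Submodule.span K (Set.range ev)), h1]
    simp
  obtain ⟨b, hb, hspan, hli⟩ := exists_linearIndependent K (Set.range ev)
  let B0 : Module.Basis b K (Module.Dual K N) :=
    Module.Basis.mk hli (by rw [Subtype.range_coe, hspan, htop])
  have : Finite b := Module.Finite.finite_basis B0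
  have : Fintype b := Fintype.ofFinite b
  let B := B0.reindex (Fintype.equivFin b)
  have hB : ∀ l, ∃ w, ev w = B l := by
    intro l
    have : B l ∈ b := by simp [B, B0]
    exact hb this
  choose t ht using hB
  let Y := B.dualBasis.map (Module.evalEquiv K N).symm
  have hY : ∀ l l', B l' (Y l) = if l = l' then 1 else 0 := by
    intro l l'
    have : (Module.evalEquiv K N (Y l)) (B l') = if l = l' then 1 else 0 := by
      simp only [Y, Module.Basis.map_apply, LinearEquiv.apply_symm_apply]
      rw [Module.Basis.dualBasis_apply_self]
      simp [eq_comm]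
    simpa using this
  refine ⟨Fintype.card b, t, fun l => Y l, ?_, fun l => (Y l).2, ?_, ?_⟩
  · rw [← Subspace.dual_finrank_eq, Module.finrank_eq_card_basis B]; simp
  · intro l l'
    rw [← hev, ht, hY]
  · intro x hx
    have : (⟨x, hx⟩ : N) = ∑ l, x.coeff (t l) • Y l := by
      rw [← sub_eq_zero, ← Module.forall_dual_apply_eq_zero_iff K]
      intro φ
      rw [← B.sum_repr φ, LinearMap.sum_apply]
      apply Finset.sum_eq_zero
      intro l _
      rw [LinearMap.smul_apply, map_sub, map_sum]
      simp only [map_smul, hY]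
      rw [← ht, hev]
      simp
    have h2 := congrArg Subtype.val this
    simpa using h2

/-- Generic echelon form over a domain. -/
lemma generic_echelon {O : Type} [CommRing O] [IsDomain O]
    (N : Submodule O (MonoidAlgebra O W)) (hN : N.FG) :
    ∃ (r : ℕ) (t : Fin r → W) (y : Fin r → MonoidAlgebra O W) (g : O), g ≠ 0 ∧
      (∀ l, y l ∈ N) ∧ (∀ x ∈ N, g • x = ∑ l, x.coeff (t l) • y l) := by
  classical
  let K := FractionRing O
  let ι : O →+* K := algebraMap O K
  have hι : Function.Injective ι := IsFractionRing.injective O K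
  let NK : Submodule K (MonoidAlgebra K W) := Submodule.span K (mp ι '' N)
  have hfin : FiniteDimensional K NK := by
    obtain ⟨s, hs⟩ := hN
    have : NK = Submodule.span K ((mp ι '' (s : Set (MonoidAlgebra O W)))) := by
      apply le_antisymm
      · rw [Submodule.span_le]
        rintro _ ⟨x, hx, rfl⟩
        rw [← hs] at hx
        induction hx using Submodule.span_induction with
        | mem x hx => exact Submodule.subset_span ⟨x, hx, rfl⟩
        | zero => simp
        | add x y _ _ hx hy => rw [map_add]; exact Submodule.add_mem _ hx hy
        | smul c x _ hx => rw [mp_smul]; exact Submodule.smul_mem _ _ hx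
      · apply Submodule.span_mono
        apply Set.image_mono
        rw [← hs]; exact Submodule.subset_span
    rw [this]
    exact FiniteDimensional.span_of_finite K ((Finset.finite_toSet s).image _)
  obtain ⟨r, t, y, -, hy, -, hx⟩ := echelon NK
  have hclear : ∀ z ∈ NK, ∃ g : O, g ≠ 0 ∧ ∃ y ∈ N, mp ι y = ι g • z := by
    intro z hz
    induction hz using Submodule.span_induction with
    | mem x hx => obtain ⟨y, hy, rfl⟩ := hx; exact ⟨1, one_ne_zero, y, hy, by simp⟩
    | zero => exact ⟨1, one_ne_zero, 0, N.zero_mem, by simp⟩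
    | add x y _ _ hx hy =>
      obtain ⟨g, hg, u, hu, e⟩ := hx
      obtain ⟨g', hg', u', hu', e'⟩ := hy
      refine ⟨g * g', mul_ne_zero hg hg', g' • u + g • u',
        N.add_mem (N.smul_mem _ hu) (N.smul_mem _ hu'), ?_⟩
      rw [map_add, mp_smul, mp_smul, e, e', map_mul, smul_add, smul_smul, smul_smul, mul_comm]
    | smul c x _ hx =>
      obtain ⟨g, hg, u, hu, e⟩ := hx
      obtain ⟨⟨n, d⟩, hc⟩ := IsLocalization.surj (nonZeroDivisors O) c
      refine ⟨g * d, mul_ne_zero hg (nonZeroDivisors.ne_zero d.2), n • u, N.smul_mem _ hu, ?_⟩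
      rw [mp_smul, e, smul_smul, smul_smul]
      congr 1
      have : c * ι d = ι n := hc
      rw [← this, map_mul]; ring
  have hc : ∀ l, ∃ g : O, g ≠ 0 ∧ ∃ z ∈ N, mp ι z = ι g • y l := fun l => hclear _ (hy l)
  choose g hg z hz e using hc
  refine ⟨r, t, fun l => (∏ j ∈ Finset.univ.erase l, g j) • z l, ∏ j, g j,
    Finset.prod_ne_zero_iff.mpr (fun j _ => hg j), fun l => N.smul_mem _ (hz l), ?_⟩
  intro x hxN
  apply MonoidAlgebra.map_injective (M := W) ι.toAddMonoidHom hι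
  change mp ι _ = mp ι _
  rw [mp_smul, map_sum]
  have h1 := hx (mp ι x) (Submodule.subset_span ⟨x, hxN, rfl⟩)
  rw [h1, Finset.smul_sum]
  apply Finset.sum_congr rfl
  intro l _
  rw [mp_smul, mp_smul, e, mp_coeff, smul_smul, smul_smul, smul_smul]
  congr 1
  rw [← Finset.mul_prod_erase Finset.univ g (Finset.mem_univ l), map_mul]
  ring

/-- fibrewise saturation: elements of `N` vanishing in the fibre are in `(ker π) N`. -/
def Star {O k : Type} [CommRing O] [Field k] (π : O →+* k)
    (N : Submodule O (MonoidAlgebra O W)) : Prop :=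
  ∀ x ∈ N, mp π x = 0 → x ∈ RingHom.ker π • N

lemma star_generic {O : Type} [CommRing O] [IsDomain O]
    (N : Submodule O (MonoidAlgebra O W)) (hN : N.FG) :
    ∃ g : O, g ≠ 0 ∧ ∀ (k : Type) [Field k] (π : O →+* k), Function.Surjective π → π g ≠ 0 →
      Star π N := by
  obtain ⟨r, t, y, g, hg, hy, hx⟩ := generic_echelon N hN
  refine ⟨g, hg, ?_⟩
  intro k _ π hπ hπg x hxN hx0
  have h1 : g • x ∈ RingHom.ker π • N := by
    rw [hx x hxN]
    apply Submodule.sum_mem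
    intro l _
    apply Submodule.smul_mem_smul _ (hy l)
    rw [RingHom.mem_ker, ← mp_coeff, hx0]; simp
  obtain ⟨g', hg'⟩ := hπ (π g)⁻¹
  have h2 : x = (1 - g' * g) • x + g' • (g • x) := by
    rw [smul_smul, ← add_smul]; simp
  rw [h2]
  refine Submodule.add_mem _ (Submodule.smul_mem_smul ?_ hxN) (Submodule.smul_mem _ _ h1)
  rw [RingHom.mem_ker]; simp [hg', hπg]

lemma finrank_fibre {O k : Type} [CommRing O] [IsDomain O] [Field k] (π : O →+* k)
    (hπ : Function.Surjective π) (N : Submodule O (MonoidAlgebra O W)) (hN : N.FG)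
    (Nk : Submodule k (MonoidAlgebra k W)) [FiniteDimensional k Nk]
    (h1 : ∀ x ∈ N, mp π x ∈ Nk) (h2 : ∀ z ∈ Nk, ∃ x ∈ N, mp π x = z)
    (hs : Star π N) : Module.finrank k Nk = Module.finrank O N := by
  classical
  obtain ⟨r, t, y, hr, hy, hyt, hx⟩ := echelon Nk
  choose z hz ez using fun l => h2 (y l) (hy l)
  have hli : LinearIndependent O z := by
    rw [Fintype.linearIndependent_iff]
    intro c hc
    let A : Matrix (Fin r) (Fin r) O := Matrix.of fun l l' => (z l).coeff (t l')
    have hA : A.det ≠ 0 := by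
      intro h0
      have := RingHom.map_det π A
      rw [h0, map_zero] at this
      have h3 : π.mapMatrix A = 1 := by
        ext l l'
        simp only [RingHom.mapMatrix_apply, Matrix.map_apply, A, Matrix.of_apply]
        rw [← mp_coeff, ez, hyt, Matrix.one_apply]
      rw [h3, Matrix.det_one] at this
      exact zero_ne_one this
    have h4 : c = 0 := by
      apply Matrix.eq_zero_of_vecMul_eq_zero hA
      ext l'
      have := congrArg (fun u => u.coeff (t l')) hc
      simpa [Matrix.vecMul, dotProduct, A, MonoidAlgebra.coeff_sum, Finsupp.finsetSum_apply] using this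
    intro i; rw [h4]; rfl
  have hle : Submodule.span O (Set.range z) ≤ N := by
    rw [Submodule.span_le]; rintro _ ⟨l, rfl⟩; exact hz l
  have hsup : N ≤ Submodule.span O (Set.range z) ⊔ RingHom.ker π • N := by
    intro x hxN
    choose c hc using fun l => hπ ((mp π x).coeff (t l))
    have h5 : x - ∑ l, c l • z l ∈ RingHom.ker π • N := by
      apply hs
      · exact N.sub_mem hxN (N.sum_mem fun l _ => N.smul_mem _ (hz l))
      · rw [map_sub, map_sum, sub_eq_zero]
        conv_lhs => rw [hx _ (h1 x hxN)]
        apply Finset.sum_congr rfl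
        intro l _
        rw [mp_smul, hc, ez]
    have h6 : x = ∑ l, c l • z l + (x - ∑ l, c l • z l) := by abel
    rw [h6]
    refine Submodule.add_mem_sup (Submodule.sum_mem _ fun l _ => Submodule.smul_mem _ _
      (Submodule.subset_span ⟨l, rfl⟩)) h5
  obtain ⟨g, hg, hgN⟩ := Submodule.exists_sub_one_mem_and_smul_le_of_fg_of_le_sup hN le_rfl hsup
  have hg0 : g ≠ 0 := by
    rintro rfl
    rw [RingHom.mem_ker] at hg
    simp at hg
  have hfin : Module.Finite O N := Module.Finite.iff_fg.mpr hN
  have hsp : Module.finrank O (Submodule.span O (Set.range z)) = r := by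
    rw [finrank_span_eq_card hli]; simp
  have hfin2 : Module.Finite O (Submodule.span O (Set.range z)) :=
    Module.Finite.span_of_finite O (Set.finite_range z)
  rw [← hr]
  apply le_antisymm
  · rw [← hsp]
    exact Submodule.finrank_mono hle
  · rw [← hsp]
    let f : N →ₗ[O] Submodule.span O (Set.range z) :=
      { toFun := fun x => ⟨g • (x : MonoidAlgebra O W), hgN (Submodule.smul_mem_pointwise_smul _ _ _ x.2)⟩
        map_add' := by intro x y; ext; simp
        map_smul' := by intro c x; apply Subtype.ext; simp [smul_comm g c] }
    apply LinearMap.finrank_le_finrank_of_injective (f := f)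
    intro x y hxy
    have h7 : g • (x : MonoidAlgebra O W) = g • (y : MonoidAlgebra O W) := congrArg Subtype.val hxy
    apply Subtype.ext
    ext w
    have h8 := congrArg (fun u => u.coeff w) h7
    simpa [hg0] using h8

end LinAlg

section Core

variable {G : Type} [Fintype G] [DecidableEq G] (wt : G → ℕ)

/-- weight of a word. -/
def wW (w : FreeMonoid G) : ℕ := (w.toList.map wt).sum

@[simp] lemma wW_one : wW wt 1 = 0 := by simp [wW]
@[simp] lemma wW_mul (u v : FreeMonoid G) : wW wt (u * v) = wW wt u + wW wt v := by simp [wW]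
@[simp] lemma wW_of (i : G) : wW wt (FreeMonoid.of i) = wt i := by simp [wW]

lemma finite_words (hwt : ∀ i, 1 ≤ wt i) (d : ℕ) : {w : FreeMonoid G | wW wt w ≤ d}.Finite := by
  have h := List.finite_length_le G d
  refine Set.Finite.subset (h.preimage (f := FreeMonoid.toList)
    (FreeMonoid.toList.injective.injOn)) ?_
  intro w hw
  have : ∀ l : List G, l.length ≤ (l.map wt).sum := by
    intro l
    induction l with
    | nil => simp
    | cons a l ih => simp; have := hwt a; omega
  simp only [Set.mem_preimage, Set.mem_ofPred_eq] at *
  exact (this _).trans hw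

variable (O : Type) [CommRing O]

/-- homogeneous elements of degree `d - e` in the free algebra. -/
def Hom (e d : ℕ) : Submodule O (MonoidAlgebra O (FreeMonoid G)) where
  carrier := {f | ∀ w, f.coeff w ≠ 0 → wW wt w + e = d}
  add_mem' := by
    intro f g hf hg w hw
    by_cases h : f.coeff w = 0
    · apply hg; intro h'; apply hw; simp [h, h']
    · exact hf w h
  zero_mem' := by intro w hw; simp at hw
  smul_mem' := by
    intro c f hf w hw
    apply hf; intro h; apply hw; simp [h]

/-- the `O`-span description of `Hom`. -/
lemma Hom_eq_span (e d : ℕ) : Hom wt O e d =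
    Submodule.span O {f | ∃ w, wW wt w + e = d ∧ f = MonoidAlgebra.single w 1} := by
  apply le_antisymm
  · intro f hf
    rw [← MonoidAlgebra.sum_coeff_single f]
    apply Submodule.sum_mem
    intro w hw
    have : (MonoidAlgebra.single w (f.coeff w) : MonoidAlgebra O (FreeMonoid G)) =
        f.coeff w • MonoidAlgebra.single w 1 := by simp
    rw [this]
    apply Submodule.smul_mem
    apply Submodule.subset_span
    exact ⟨w, hf w (by simpa using hw), rfl⟩
  · rw [Submodule.span_le]
    rintro _ ⟨w, hw, rfl⟩ w' hw'
    simp only [MonoidAlgebra.coeff_single, Finsupp.single_apply] at hw'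
    by_cases h : w = w'
    · rw [← h]; exact hw
    · simp [h] at hw'

variable {O}

lemma single_mem_Hom {e d : ℕ} {w : FreeMonoid G} (h : wW wt w + e = d) (c : O) :
    MonoidAlgebra.single w c ∈ Hom wt O e d := by
  have : (MonoidAlgebra.single w c : MonoidAlgebra O (FreeMonoid G)) =
        c • MonoidAlgebra.single w 1 := by simp
  rw [this, Hom_eq_span]
  exact Submodule.smul_mem _ _ (Submodule.subset_span ⟨w, h, rfl⟩)

lemma Hom_mul {e m d : ℕ} {f g : MonoidAlgebra O (FreeMonoid G)}
    (hf : f ∈ Hom wt O e m) (hg : g ∈ Hom wt O m d) : f * g ∈ Hom wt O e d := by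
  rw [Hom_eq_span] at hf
  induction hf using Submodule.span_induction with
  | mem f hf =>
    obtain ⟨u, hu, rfl⟩ := hf
    rw [Hom_eq_span] at hg
    induction hg using Submodule.span_induction with
    | mem g hg =>
      obtain ⟨v, hv, rfl⟩ := hg
      rw [MonoidAlgebra.single_mul_single]
      apply single_mem_Hom
      rw [wW_mul]; omega
    | zero => simp
    | add x y _ _ hx hy => rw [mul_add]; exact Submodule.add_mem _ hx hy
    | smul c x _ hx => rw [mul_smul_comm]; exact Submodule.smul_mem _ _ hx
  | zero => simp
  | add x y _ _ hx hy => rw [add_mul]; exact Submodule.add_mem _ hx hy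
  | smul c x _ hx => rw [smul_mul_assoc]; exact Submodule.smul_mem _ _ hx

/-- the generators of the free algebra. -/
noncomputable def X (O : Type) [CommRing O] (i : G) : MonoidAlgebra O (FreeMonoid G) :=
  MonoidAlgebra.single (FreeMonoid.of i) 1

lemma X_mem (i : G) : X O i ∈ Hom wt O 0 (wt i) := single_mem_Hom wt (by simp) 1

/-- left derivative. -/
noncomputable def D (i : G) : MonoidAlgebra O (FreeMonoid G) →ₗ[O] MonoidAlgebra O (FreeMonoid G) where
  toFun f := MonoidAlgebra.comapDomain (fun w => FreeMonoid.of i * w) (mul_right_injective _) f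
  map_add' f g := by ext; simp
  map_smul' c f := by ext; simp

lemma D_coeff (i : G) (f : MonoidAlgebra O (FreeMonoid G)) (w : FreeMonoid G) :
    (D i f).coeff w = f.coeff (FreeMonoid.of i * w) := by
  simp [D]

lemma D_X_mul (i j : G) (f : MonoidAlgebra O (FreeMonoid G)) :
    D i (X O j * f) = if i = j then f else 0 := by
  ext w
  rw [D_coeff, X]
  by_cases h : i = j
  · subst h
    rw [MonoidAlgebra.coeff_single_mul_mul]; simp
  · rw [MonoidAlgebra.coeff_single_mul_of_forall_mul_ne]
    · simp [h]
    · intro d hd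
      have := congrArg FreeMonoid.toList hd
      simp at this
      exact h this.1.symm

lemma D_sum_X (i : G) (y : G → MonoidAlgebra O (FreeMonoid G)) :
    D i (∑ j, X O j * y j) = y i := by
  rw [map_sum]
  simp [D_X_mul]

lemma sum_X_D {d : ℕ} (hd : 1 ≤ d) {f : MonoidAlgebra O (FreeMonoid G)} (hf : f ∈ Hom wt O 0 d) :
    f = ∑ i, X O i * D i f := by
  ext w
  rw [MonoidAlgebra.coeff_sum, Finsupp.finsetSum_apply]
  induction w using FreeMonoid.casesOn with
  | one =>
    rw [Finset.sum_eq_zero]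
    · by_contra h
      have := hf _ h
      simp at this; omega
    · intro i _
      rw [X, MonoidAlgebra.coeff_single_mul_of_forall_mul_ne]
      intro d hd
      have := congrArg FreeMonoid.toList hd
      simp at this
  | of_mul j w =>
    rw [Finset.sum_eq_single j]
    · rw [X, MonoidAlgebra.coeff_single_mul_mul, D_coeff]; simp
    · intro i _ hi
      rw [X, MonoidAlgebra.coeff_single_mul_of_forall_mul_ne]
      intro d hd
      have := congrArg FreeMonoid.toList hd
      simp at this
      exact hi this.1
    · simp

lemma D_mul (i : G) {d : ℕ} (hd : 1 ≤ d) {f : MonoidAlgebra O (FreeMonoid G)}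
    (hf : f ∈ Hom wt O 0 d) (g : MonoidAlgebra O (FreeMonoid G)) :
    D i (f * g) = D i f * g := by
  conv_lhs => rw [sum_X_D wt hd hf, Finset.sum_mul]
  simp only [mul_assoc]
  rw [D_sum_X]

lemma D_mem (i : G) {e d : ℕ} {f : MonoidAlgebra O (FreeMonoid G)}
    (hf : f ∈ Hom wt O e d) : D i f ∈ Hom wt O (wt i + e) d := by
  intro w hw
  rw [D_coeff] at hw
  have := hf _ hw
  simp at this; omega

lemma D_mp {k : Type} [CommRing k] (π : O →+* k) (i : G) (f : MonoidAlgebra O (FreeMonoid G)) :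
    D i (mp π f) = mp π (D i f) := by
  ext w
  rw [D_coeff, mp_coeff, mp_coeff, D_coeff]

lemma X_mp {k : Type} [CommRing k] (π : O →+* k) (i : G) : mp π (X O i) = X k i := by
  simp [X, mp]

lemma Hom_mp {k : Type} [CommRing k] (π : O →+* k) {e d : ℕ} {f : MonoidAlgebra O (FreeMonoid G)}
    (hf : f ∈ Hom wt O e d) : mp π f ∈ Hom wt k e d := by
  intro w hw
  rw [mp_coeff] at hw
  apply hf; intro h; rw [h] at hw; simp at hw

lemma Hom_lift {k : Type} [CommRing k] (π : O →+* k) (hπ : Function.Surjective π) {e d : ℕ}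
    {f : MonoidAlgebra k (FreeMonoid G)}
    (hf : f ∈ Hom wt k e d) : ∃ f' ∈ Hom wt O e d, mp π f' = f := by
  rw [Hom_eq_span] at hf
  induction hf using Submodule.span_induction with
  | mem f hf =>
    obtain ⟨w, hw, rfl⟩ := hf
    exact ⟨_, single_mem_Hom wt hw 1, by simp [mp]⟩
  | zero => exact ⟨0, Submodule.zero_mem _, by simp⟩
  | add x y _ _ hx hy =>
    obtain ⟨x', hx', rfl⟩ := hx
    obtain ⟨y', hy', rfl⟩ := hy
    exact ⟨_, Submodule.add_mem _ hx' hy', map_add _ _ _⟩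
  | smul c x _ hx =>
    obtain ⟨x', hx', rfl⟩ := hx
    obtain ⟨c, rfl⟩ := hπ c
    exact ⟨_, Submodule.smul_mem _ c hx', mp_smul _ _ _⟩

lemma Hom_ker {k : Type} [CommRing k] (π : O →+* k) {e d : ℕ}
    {f : MonoidAlgebra O (FreeMonoid G)} (hf : f ∈ Hom wt O e d) (h0 : mp π f = 0) :
    f ∈ RingHom.ker π • Hom wt O e d := by
  rw [← MonoidAlgebra.sum_coeff_single f]
  apply Submodule.sum_mem
  intro w hw
  have : (MonoidAlgebra.single w (f.coeff w) : MonoidAlgebra O (FreeMonoid G)) =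
      f.coeff w • MonoidAlgebra.single w 1 := by simp
  simp only [this]
  apply Submodule.smul_mem_smul
  · rw [RingHom.mem_ker, ← mp_coeff, h0]; simp
  · exact single_mem_Hom wt (hf w (by simpa using hw)) 1

variable {J : Type} [Fintype J] [DecidableEq J] (deg : J → ℕ)

/-- the degree `d - e` part of the two-sided ideal generated by the relations. -/
noncomputable def II (r : J → MonoidAlgebra O (FreeMonoid G)) (e d : ℕ) :
    Submodule O (MonoidAlgebra O (FreeMonoid G)) :=
  Submodule.span O {z | ∃ u j v, wW wt u + deg j + wW wt v + e = d ∧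
    z = MonoidAlgebra.single u 1 * r j * MonoidAlgebra.single v 1}

variable {wt deg} {r : J → MonoidAlgebra O (FreeMonoid G)}

lemma II_eq {e d : ℕ} (h : e ≤ d) : II wt deg r e d = II wt deg r 0 (d - e) := by
  have : ∀ u j v, (wW wt u + deg j + wW wt v + e = d) ↔
      (wW wt u + deg j + wW wt v + 0 = d - e) := by intros; omega
  simp only [II, this]

lemma II_bot {e d : ℕ} (h : d < e) : II wt deg r e d = ⊥ := by
  rw [II, Submodule.span_eq_bot]
  rintro x ⟨u, j, v, hh, -⟩
  omega

lemma Hom_mul_II {e m d : ℕ} {f x : MonoidAlgebra O (FreeMonoid G)}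
    (hf : f ∈ Hom wt O e m) (hx : x ∈ II wt deg r m d) : f * x ∈ II wt deg r e d := by
  rw [Hom_eq_span] at hf
  induction hf using Submodule.span_induction with
  | mem f hf =>
    obtain ⟨u, hu, rfl⟩ := hf
    induction hx using Submodule.span_induction with
    | mem g hg =>
      obtain ⟨v, j, v', hv, rfl⟩ := hg
      apply Submodule.subset_span
      refine ⟨u * v, j, v', by rw [wW_mul]; omega, ?_⟩
      rw [← mul_assoc, ← mul_assoc, MonoidAlgebra.single_mul_single, one_mul]
    | zero => simp
    | add x y _ _ hx hy => rw [mul_add]; exact Submodule.add_mem _ hx hy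
    | smul c x _ hx => rw [mul_smul_comm]; exact Submodule.smul_mem _ _ hx
  | zero => simp
  | add x y _ _ hx hy => rw [add_mul]; exact Submodule.add_mem _ hx hy
  | smul c x _ hx => rw [smul_mul_assoc]; exact Submodule.smul_mem _ _ hx

lemma II_mul_Hom {e m d : ℕ} {f x : MonoidAlgebra O (FreeMonoid G)}
    (hx : x ∈ II wt deg r e m) (hf : f ∈ Hom wt O m d) : x * f ∈ II wt deg r e d := by
  rw [Hom_eq_span] at hf
  induction hf using Submodule.span_induction with
  | mem f hf =>
    obtain ⟨u, hu, rfl⟩ := hf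
    induction hx using Submodule.span_induction with
    | mem g hg =>
      obtain ⟨v, j, v', hv, rfl⟩ := hg
      apply Submodule.subset_span
      refine ⟨v, j, v' * u, by rw [wW_mul]; omega, ?_⟩
      rw [mul_assoc, MonoidAlgebra.single_mul_single, one_mul]
    | zero => simp
    | add x y _ _ hx hy => rw [add_mul]; exact Submodule.add_mem _ hx hy
    | smul c x _ hx => rw [smul_mul_assoc]; exact Submodule.smul_mem _ _ hx
  | zero => simp
  | add x y _ _ hx hy => rw [mul_add]; exact Submodule.add_mem _ hx hy
  | smul c x _ hx => rw [mul_smul_comm]; exact Submodule.smul_mem _ _ hx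

lemma r_mem_II (j : J) : r j ∈ II wt deg r 0 (deg j) := by
  apply Submodule.subset_span
  refine ⟨1, j, 1, by simp, ?_⟩
  rw [← MonoidAlgebra.one_def]; simp

lemma r_mul_mem {d : ℕ} (j : J) {f : MonoidAlgebra O (FreeMonoid G)}
    (hf : f ∈ Hom wt O (deg j) d) : r j * f ∈ II wt deg r 0 d :=
  II_mul_Hom (r_mem_II j) hf

lemma X_mul_mem {d : ℕ} (i : G) {f : MonoidAlgebra O (FreeMonoid G)}
    (hf : f ∈ II wt deg r (wt i) d) : X O i * f ∈ II wt deg r 0 d :=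
  Hom_mul_II (X_mem wt i) hf

lemma II_decomp {d : ℕ} {x : MonoidAlgebra O (FreeMonoid G)} (hx : x ∈ II wt deg r 0 d) :
    ∃ (f : J → MonoidAlgebra O (FreeMonoid G)) (y : G → MonoidAlgebra O (FreeMonoid G)),
      (∀ j, f j ∈ Hom wt O (deg j) d) ∧ (∀ i, y i ∈ II wt deg r (wt i) d) ∧
      x = ∑ j, r j * f j + ∑ i, X O i * y i := by
  induction hx using Submodule.span_induction with
  | mem x hx =>
    obtain ⟨u, j, v, h, rfl⟩ := hx
    induction u using FreeMonoid.casesOn with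
    | one =>
      refine ⟨Pi.single j (MonoidAlgebra.single v 1), 0, ?_, ?_, ?_⟩
      · intro j'
        by_cases hj : j' = j
        · subst hj
          rw [Pi.single_eq_same]
          apply single_mem_Hom
          simp at h; omega
        · rw [Pi.single_eq_of_ne hj]; exact Submodule.zero_mem _
      · intro i; exact Submodule.zero_mem _
      · rw [Finset.sum_eq_single j]
        · rw [← MonoidAlgebra.one_def]; simp
        · intro j' _ hj; rw [Pi.single_eq_of_ne hj, mul_zero]
        · simp
    | of_mul i u =>
      refine ⟨0, Pi.single i (MonoidAlgebra.single u 1 * r j * MonoidAlgebra.single v 1), ?_, ?_, ?_⟩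
      · intro i; exact Submodule.zero_mem _
      · intro i'
        by_cases hj : i' = i
        · subst hj
          rw [Pi.single_eq_same]
          apply Submodule.subset_span
          refine ⟨u, j, v, ?_, rfl⟩
          simp at h; omega
        · rw [Pi.single_eq_of_ne hj]; exact Submodule.zero_mem _
      · rw [Finset.sum_eq_single (a := i)]
        · rw [Pi.single_eq_same, X, ← mul_assoc, ← mul_assoc, MonoidAlgebra.single_mul_single]
          simp
        · intro j' _ hj; rw [Pi.single_eq_of_ne hj, mul_zero]
        · simp
  | zero => exact ⟨0, 0, fun _ => Submodule.zero_mem _, fun _ => Submodule.zero_mem _, by simp⟩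
  | add x1 x2 _ _ hx1 hx2 =>
    obtain ⟨f, y, hf, hy, rfl⟩ := hx1
    obtain ⟨f', y', hf', hy', rfl⟩ := hx2
    refine ⟨f + f', y + y', fun j => Submodule.add_mem _ (hf j) (hf' j),
      fun j => Submodule.add_mem _ (hy j) (hy' j), ?_⟩
    simp only [Pi.add_apply, mul_add, Finset.sum_add_distrib]; abel
  | smul c x _ hx =>
    obtain ⟨f, y, hf, hy, rfl⟩ := hx
    refine ⟨c • f, c • y, fun j => Submodule.smul_mem _ _ (hf j),
      fun j => Submodule.smul_mem _ _ (hy j), ?_⟩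
    simp only [Pi.smul_apply, mul_smul_comm, ← Finset.smul_sum, smul_add]

lemma II_fg (hwt : ∀ i, 1 ≤ wt i) (e d : ℕ) : (II wt deg r e d).FG := by
  apply Submodule.fg_span
  have h1 := finite_words wt hwt d
  refine Set.Finite.subset ((h1.prod ((Set.finite_univ (α := J)).prod h1)).image
    (fun p => MonoidAlgebra.single p.1 1 * r p.2.1 * MonoidAlgebra.single p.2.2 1)) ?_
  rintro _ ⟨u, j, v, h, rfl⟩
  refine ⟨(u, j, v), ⟨?_, ⟨Set.mem_univ _, ?_⟩⟩, rfl⟩ <;> simp <;> omega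

lemma II_mp {k : Type} [CommRing k] (π : O →+* k) {e d : ℕ} {x : MonoidAlgebra O (FreeMonoid G)}
    (hx : x ∈ II wt deg r e d) : mp π x ∈ II wt deg (fun j => mp π (r j)) e d := by
  induction hx using Submodule.span_induction with
  | mem x hx =>
    obtain ⟨u, j, v, h, rfl⟩ := hx
    apply Submodule.subset_span
    exact ⟨u, j, v, h, by simp [mp]⟩
  | zero => simp
  | add x y _ _ hx hy => rw [map_add]; exact Submodule.add_mem _ hx hy
  | smul c x _ hx => rw [mp_smul]; exact Submodule.smul_mem _ _ hx

lemma II_lift {k : Type} [CommRing k] (π : O →+* k) (hπ : Function.Surjective π) {e d : ℕ}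
    {x : MonoidAlgebra k (FreeMonoid G)}
    (hx : x ∈ II wt deg (fun j => mp π (r j)) e d) : ∃ x' ∈ II wt deg r e d, mp π x' = x := by
  induction hx using Submodule.span_induction with
  | mem x hx =>
    obtain ⟨u, j, v, h, rfl⟩ := hx
    exact ⟨_, Submodule.subset_span ⟨u, j, v, h, rfl⟩, by simp [mp]⟩
  | zero => exact ⟨0, Submodule.zero_mem _, by simp⟩
  | add x y _ _ hx hy =>
    obtain ⟨x', hx', rfl⟩ := hx
    obtain ⟨y', hy', rfl⟩ := hy
    exact ⟨_, Submodule.add_mem _ hx' hy', map_add _ _ _⟩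
  | smul c x _ hx =>
    obtain ⟨x', hx', rfl⟩ := hx
    obtain ⟨c, rfl⟩ := hπ c
    exact ⟨_, Submodule.smul_mem _ c hx', mp_smul _ _ _⟩

variable (wt deg r)

/-- homogeneous syzygies (in degree `d`) of the relations, lifted to the free algebra. -/
def Syz (d : ℕ) : Set (J → MonoidAlgebra O (FreeMonoid G)) :=
  {f | (∀ j, f j ∈ Hom wt O (deg j) d) ∧
    ∃ y : G → MonoidAlgebra O (FreeMonoid G), (∀ i, y i ∈ II wt deg r (wt i) d) ∧
      ∑ j, r j * f j = ∑ i, X O i * y i}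

/-- the syzygies are generated in degrees `≤ c`. -/
def Good (c : ℕ) : Prop :=
  ∀ d, ∀ f ∈ Syz wt deg r d, f ∈ Submodule.span O
    ({t | ∀ j, t j ∈ II wt deg r (deg j) d} ∪
      {t | ∃ m ≤ c, ∃ s ∈ Syz wt deg r m, ∃ q ∈ Hom wt O m d, t = fun j => s j * q})

variable {wt deg r}

lemma Star_shift {k : Type} [Field k] (π : O →+* k) {e d : ℕ}
    (h : ∀ m, m + e ≤ d → Star π (II wt deg r 0 m)) : Star π (II wt deg r e d) := by
  by_cases he : e ≤ d
  · rw [II_eq he]; apply h; omega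
  · rw [II_bot (by omega)]
    intro x hx _
    rw [Submodule.mem_bot] at hx
    rw [hx]; exact Submodule.zero_mem _

lemma Syz_lift {k : Type} [Field k] (π : O →+* k) (hπ : Function.Surjective π) {m : ℕ}
    (hst : Star π (II wt deg r 0 m)) {s : J → MonoidAlgebra k (FreeMonoid G)}
    (hs : s ∈ Syz wt deg (fun j => mp π (r j)) m) :
    ∃ s' ∈ Syz wt deg r m, (fun j => mp π (s' j)) = s := by
  obtain ⟨hs1, y, hy, e⟩ := hs
  choose s1 hs1' es1 using fun j => Hom_lift wt π hπ (hs1 j)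
  choose y1 hy1 ey1 using fun i => II_lift π hπ (hy i)
  have h1 : ∑ j, r j * s1 j - ∑ i, X O i * y1 i ∈ RingHom.ker π • II wt deg r 0 m := by
    apply hst
    · exact Submodule.sub_mem _ (Submodule.sum_mem _ fun j _ => r_mul_mem j (hs1' j))
        (Submodule.sum_mem _ fun i _ => X_mul_mem i (hy1 i))
    · rw [map_sub, map_sum, map_sum, sub_eq_zero]
      simp only [map_mul, es1, ey1, X_mp]
      exact e
  have h2 : ∀ x ∈ RingHom.ker π • II wt deg r 0 m,
      ∃ (f : J → MonoidAlgebra O (FreeMonoid G)) (y : G → MonoidAlgebra O (FreeMonoid G)),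
      (∀ j, f j ∈ Hom wt O (deg j) m) ∧ (∀ j, mp π (f j) = 0) ∧
      (∀ i, y i ∈ II wt deg r (wt i) m) ∧
      x = ∑ j, r j * f j + ∑ i, X O i * y i := by
    intro x hx
    refine Submodule.smul_induction_on hx (fun c hc x hx => ?_) (fun x1 x2 hx1 hx2 => ?_)
    · obtain ⟨f, y, hf, hy, rfl⟩ := II_decomp hx
      refine ⟨c • f, c • y, fun j => Submodule.smul_mem _ _ (hf j), ?_,
        fun j => Submodule.smul_mem _ _ (hy j), ?_⟩
      · intro j
        rw [RingHom.mem_ker] at hc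
        rw [Pi.smul_apply, mp_smul, hc, zero_smul]
      · simp only [Pi.smul_apply, mul_smul_comm, ← Finset.smul_sum, smul_add]
    · obtain ⟨f, y, hf, h0, hy, rfl⟩ := hx1
      obtain ⟨f', y', hf', h0', hy', rfl⟩ := hx2
      refine ⟨f + f', y + y', fun j => Submodule.add_mem _ (hf j) (hf' j), ?_,
        fun j => Submodule.add_mem _ (hy j) (hy' j), ?_⟩
      · intro j
        rw [Pi.add_apply, map_add, h0, h0', add_zero]
      · simp only [Pi.add_apply, mul_add, Finset.sum_add_distrib]; abel
  obtain ⟨f, y2, hf, hf0, hy2, e2⟩ := h2 _ h1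
  refine ⟨fun j => s1 j - f j, ⟨fun j => Submodule.sub_mem _ (hs1' j) (hf j),
    fun i => y1 i + y2 i, fun i => Submodule.add_mem _ (hy1 i) (hy2 i), ?_⟩, ?_⟩
  · simp only [mul_sub, mul_add, Finset.sum_sub_distrib, Finset.sum_add_distrib]
    rw [sub_eq_iff_eq_add] at e2
    rw [e2]; abel
  · ext1 j
    rw [map_sub, es1, hf0, sub_zero]

lemma Syz_add {d : ℕ} {f g : J → MonoidAlgebra O (FreeMonoid G)} (hf : f ∈ Syz wt deg r d)
    (hg : g ∈ Syz wt deg r d) : f + g ∈ Syz wt deg r d := by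
  obtain ⟨hf, y, hy, e⟩ := hf
  obtain ⟨hf', y', hy', e'⟩ := hg
  refine ⟨fun j => Submodule.add_mem _ (hf j) (hf' j), y + y',
        fun j => Submodule.add_mem _ (hy j) (hy' j), ?_⟩
  simp only [Pi.add_apply, mul_add, Finset.sum_add_distrib, e, e']

lemma Syz_smul {d : ℕ} {f : J → MonoidAlgebra O (FreeMonoid G)} (c : O)
    (hf : f ∈ Syz wt deg r d) : c • f ∈ Syz wt deg r d := by
  obtain ⟨hf, y, hy, e⟩ := hf
  refine ⟨fun j => Submodule.smul_mem _ _ (hf j), c • y,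
        fun j => Submodule.smul_mem _ _ (hy j), ?_⟩
  simp only [Pi.smul_apply, mul_smul_comm, ← Finset.smul_sum, e]

lemma Syz_mul {d m : ℕ} {f : J → MonoidAlgebra O (FreeMonoid G)}
    {q : MonoidAlgebra O (FreeMonoid G)}
    (hf : f ∈ Syz wt deg r m) (hq : q ∈ Hom wt O m d) : (fun j => f j * q) ∈ Syz wt deg r d := by
  obtain ⟨hf, y, hy, e⟩ := hf
  refine ⟨fun j => Hom_mul wt (hf j) hq, fun i => y i * q, fun i => II_mul_Hom (hy i) hq, ?_⟩
  simp only [← mul_assoc, ← Finset.sum_mul, e]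

lemma II_le_Hom (hr : ∀ j, r j ∈ Hom wt O 0 (deg j)) (e d : ℕ) :
    II wt deg r e d ≤ Hom wt O e d := by
  rw [II, Submodule.span_le]
  rintro _ ⟨u, j, v, h, rfl⟩
  have h1 : (MonoidAlgebra.single u 1 : MonoidAlgebra O (FreeMonoid G)) ∈ Hom wt O e (wW wt u + e) :=
    single_mem_Hom wt rfl 1
  have h2 : r j ∈ Hom wt O (wW wt u + e) (wW wt u + e + deg j) := by
    intro w hw; have := hr j w hw; omega
  have h3 : (MonoidAlgebra.single v 1 : MonoidAlgebra O (FreeMonoid G)) ∈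
      Hom wt O (wW wt u + e + deg j) d :=
    single_mem_Hom wt (by omega) 1
  exact Hom_mul wt (Hom_mul wt h1 h2) h3

lemma II_Syz (hdeg : ∀ j, 1 ≤ deg j) (hr : ∀ j, r j ∈ Hom wt O 0 (deg j)) {d : ℕ}
    {t : J → MonoidAlgebra O (FreeMonoid G)} (ht : ∀ j, t j ∈ II wt deg r (deg j) d) :
    t ∈ Syz wt deg r d := by
  refine ⟨fun j => II_le_Hom hr _ _ (ht j), fun i => ∑ j, D i (r j) * t j, ?_, ?_⟩
  · intro i
    exact Submodule.sum_mem _ fun j _ => Hom_mul_II (D_mem wt i (hr j)) (ht j)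
  · simp only [Finset.mul_sum]
    rw [Finset.sum_comm]
    apply Finset.sum_congr rfl
    intro j _
    conv_lhs => rw [sum_X_D wt (hdeg j) (hr j)]
    rw [Finset.sum_mul]
    simp only [mul_assoc]

/-- The key lemma: saturation in degrees `≤ c` propagates. -/
theorem star_all (hwt : ∀ i, 1 ≤ wt i) (hdeg : ∀ j, 1 ≤ deg j)
    (hr : ∀ j, r j ∈ Hom wt O 0 (deg j)) {k : Type} [Field k] (π : O →+* k)
    (hπ : Function.Surjective π) {c : ℕ} (hgood : Good wt deg (fun j => mp π (r j)) c)
    (hst : ∀ m ≤ c, Star π (II wt deg r 0 m)) (d : ℕ) : Star π (II wt deg r 0 d) := by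
  induction d using Nat.strong_induction_on with
  | _ d ih =>
  intro x hx hx0
  obtain ⟨f, y, hf, hy, rfl⟩ := II_decomp hx
  have hsyz : (fun j => mp π (f j)) ∈ Syz wt deg (fun j => mp π (r j)) d := by
    refine ⟨fun j => Hom_mp wt π (hf j), fun i => - mp π (y i),
      fun i => Submodule.neg_mem _ (II_mp π (hy i)), ?_⟩
    rw [map_add, map_sum, map_sum] at hx0
    simp only [map_mul, X_mp] at hx0
    simp only [mul_neg, Finset.sum_neg_distrib]
    rwa [← add_eq_zero_iff_eq_neg]
  have hlift : ∃ f' ∈ Syz wt deg r d, (fun j => mp π (f' j)) = (fun j => mp π (f j)) := by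
    have := hgood d _ hsyz
    generalize (fun j => mp π (f j)) = F at this
    induction this using Submodule.span_induction with
    | mem t ht =>
      rcases ht with ht | ⟨m, hm, s, hs, q, hq, rfl⟩
      · choose t' ht' et' using fun j => II_lift π hπ (ht j)
        exact ⟨t', II_Syz hdeg hr ht', funext et'⟩
      · obtain ⟨s', hs', rfl⟩ := Syz_lift π hπ (hst m hm) hs
        obtain ⟨q', hq', rfl⟩ := Hom_lift wt π hπ hq
        exact ⟨_, Syz_mul hs' hq', funext fun j => map_mul _ _ _⟩
    | zero => exact ⟨0, II_Syz hdeg hr (fun j => Submodule.zero_mem _), by ext1 j; simp⟩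
    | add x y _ _ hx hy =>
      obtain ⟨x', hx', rfl⟩ := hx
      obtain ⟨y', hy', rfl⟩ := hy
      exact ⟨_, Syz_add hx' hy', funext fun j => map_add _ _ _⟩
    | smul a x _ hx =>
      obtain ⟨x', hx', rfl⟩ := hx
      obtain ⟨a, rfl⟩ := hπ a
      exact ⟨_, Syz_smul a hx', funext fun j => mp_smul _ _ _⟩
  obtain ⟨f', ⟨hf', y', hy', e'⟩, ef'⟩ := hlift
  have h1 : ∑ j, r j * (f j - f' j) ∈ RingHom.ker π • II wt deg r 0 d := by
    apply Submodule.sum_mem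
    intro j _
    have h2 : f j - f' j ∈ RingHom.ker π • Hom wt O (deg j) d := by
      apply Hom_ker _ _ (Submodule.sub_mem _ (hf j) (hf' j))
      rw [map_sub, sub_eq_zero]
      exact (congrFun ef' j).symm
    refine Submodule.smul_induction_on h2 (fun a ha z hz => ?_) (fun x y hx hy => ?_)
    · rw [mul_smul_comm]
      exact Submodule.smul_mem_smul ha (r_mul_mem j hz)
    · rw [mul_add]; exact Submodule.add_mem _ hx hy
  have h3 : ∑ j, r j * f j + ∑ i, X O i * y i =
      ∑ j, r j * (f j - f' j) + ∑ i, X O i * (y' i + y i) := by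
    simp only [mul_sub, mul_add, Finset.sum_sub_distrib, Finset.sum_add_distrib, e']; abel
  have hker0 : ∀ z ∈ RingHom.ker π • II wt deg r 0 d, mp π z = 0 := by
    intro z hz
    refine Submodule.smul_induction_on hz (fun a ha z hz => ?_) (fun x y hx hy => ?_)
    · rw [RingHom.mem_ker] at ha; rw [mp_smul, ha, zero_smul]
    · rw [map_add, hx, hy, add_zero]
  rw [h3] at hx0 ⊢
  rw [map_add, hker0 _ h1, zero_add] at hx0
  apply Submodule.add_mem _ h1
  apply Submodule.sum_mem
  intro i _
  have h4 : mp π (y' i + y i) = 0 := by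
    have := D_sum_X i (fun i => y' i + y i)
    rw [← this, ← D_mp, hx0, map_zero]
  have h5 : y' i + y i ∈ RingHom.ker π • II wt deg r (wt i) d := by
    apply Star_shift π _ _ (Submodule.add_mem _ (hy' i) (hy i)) h4
    intro m hm
    apply ih; have := hwt i; omega
  refine Submodule.smul_induction_on h5 (fun a ha z hz => ?_) (fun x y hx hy => ?_)
  · rw [mul_smul_comm]
    exact Submodule.smul_mem_smul ha (X_mul_mem i hz)
  · rw [mul_add]; exact Submodule.add_mem _ hx hy

end Core
section Noeth

variable {G : Type} [Fintype G] [DecidableEq G] {wt : G → ℕ}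
  {J : Type} [Fintype J] [DecidableEq J] {deg : J → ℕ}

/-- the Hilbert functions of the ideals attached to the good `k`-points of `V(I)`. -/
def PtSer (wt : G → ℕ) (deg : J → ℕ) {P : Type} [CommRing P]
    (r : J → MonoidAlgebra P (FreeMonoid G)) (c : ℕ) (k : Type) [Field k] (I : Ideal P) :
    Set (ℕ → ℕ) :=
  {s | ∃ π : P →+* k, Function.Surjective π ∧ I ≤ RingHom.ker π ∧
    Good wt deg (fun j => mp π (r j)) c ∧
    s = fun d => Module.finrank k (II wt deg (fun j => mp π (r j)) 0 d)}

theorem ptSer_finite (hwt : ∀ i, 1 ≤ wt i) (hdeg : ∀ j, 1 ≤ deg j) {P : Type} [CommRing P]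
    [IsNoetherianRing P]
    (r : J → MonoidAlgebra P (FreeMonoid G)) (hr : ∀ j, r j ∈ Hom wt P 0 (deg j))
    (c : ℕ) (k : Type) [Field k] (I : Ideal P) : (PtSer wt deg r c k I).Finite := by
  induction I using WellFoundedGT.induction with
  | _ I ih =>
  by_cases hI : I.IsPrime
  · -- generic flatness
    let rO : J → MonoidAlgebra (P ⧸ I) (FreeMonoid G) := fun j => mp (Ideal.Quotient.mk I) (r j)
    have hrO : ∀ j, rO j ∈ Hom wt (P ⧸ I) 0 (deg j) := fun j => Hom_mp wt _ (hr j)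
    choose g hg0 hg using fun d => star_generic (II wt deg rO 0 d) (II_fg hwt 0 d)
    have hG : (∏ d ∈ Finset.range (c + 1), g d) ≠ 0 :=
      Finset.prod_ne_zero_iff.mpr fun d _ => hg0 d
    obtain ⟨f, hf⟩ := Ideal.Quotient.mk_surjective (∏ d ∈ Finset.range (c + 1), g d)
    have hfI : f ∉ I := by
      intro h
      rw [Ideal.Quotient.eq_zero_iff_mem.mpr h] at hf
      exact hG hf.symm
    have hlt : I < I ⊔ Ideal.span {f} := by
      refine lt_of_le_of_ne le_sup_left fun h => hfI ?_
      rw [h]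
      exact (le_sup_right : _ ≤ I ⊔ Ideal.span {f}) (Ideal.mem_span_singleton_self f)
    refine Set.Finite.subset ((ih _ hlt).union (Set.finite_singleton
      (fun d => Module.finrank (P ⧸ I) (II wt deg rO 0 d)))) ?_
    rintro s ⟨π, hπ, hle, hgood, rfl⟩
    by_cases hπf : π f = 0
    · left
      refine ⟨π, hπ, sup_le hle ?_, hgood, rfl⟩
      rw [Ideal.span_singleton_le_iff_mem]
      exact hπf
    · right
      let π' : P ⧸ I →+* k := Ideal.Quotient.lift I π hle
      have hl : ∀ x, π' (Ideal.Quotient.mk I x) = π x := fun x => rfl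
      have hπ' : Function.Surjective π' := by
        intro y
        obtain ⟨x, rfl⟩ := hπ y
        exact ⟨Ideal.Quotient.mk I x, hl x⟩
      have hmm : ∀ j, mp π' (rO j) = mp π (r j) := by
        intro j
        ext w
        simp only [rO, mp_coeff]
        exact hl _
      have hfun : (fun j => mp π (r j)) = (fun j => mp π' (rO j)) := funext fun j => (hmm j).symm
      rw [hfun] at hgood ⊢
      have hst0 : ∀ m ≤ c, Star π' (II wt deg rO 0 m) := by
        intro m hm
        apply hg m k π' hπ'
        intro h0
        apply hπf
        have : π f = π' (Ideal.Quotient.mk I f) := (hl f).symm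
        rw [this, hf, map_prod]
        exact Finset.prod_eq_zero (Finset.mem_range.mpr (by omega)) h0
      have hst := star_all hwt hdeg hrO π' hπ' hgood hst0
      rw [Set.mem_singleton_iff]
      ext1 d
      have : FiniteDimensional k (II wt deg (fun j => mp π' (rO j)) 0 d) :=
        Module.Finite.iff_fg.mpr (II_fg hwt 0 d)
      exact finrank_fibre π' hπ' _ (II_fg hwt 0 d) _ (fun x hx => II_mp π' hx)
        (fun z hz => II_lift π' hπ' hz) (hst d)
  · by_cases htop : I = ⊤
    · refine Set.Finite.subset Set.finite_empty ?_
      rintro s ⟨π, hπ, hle, -, -⟩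
      exfalso
      rw [htop] at hle
      have : (1 : P) ∈ RingHom.ker π := hle trivial
      simp [RingHom.mem_ker] at this
    · rw [Ideal.isPrime_iff] at hI
      push Not at hI
      obtain ⟨x, y, hxy, hx, hy⟩ := hI htop
      have hlt : ∀ f, f ∉ I → I < I ⊔ Ideal.span {f} := by
        intro f hfI
        refine lt_of_le_of_ne le_sup_left fun h => hfI ?_
        rw [h]
        exact (le_sup_right : _ ≤ I ⊔ Ideal.span {f}) (Ideal.mem_span_singleton_self f)
      refine Set.Finite.subset ((ih _ (hlt x hx)).union (ih _ (hlt y hy))) ?_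
      rintro s ⟨π, hπ, hle, hgood, rfl⟩
      have : π x * π y = 0 := by rw [← map_mul]; exact hle hxy
      rcases mul_eq_zero.mp this with h | h
      · left
        refine ⟨π, hπ, sup_le hle ?_, hgood, rfl⟩
        rw [Ideal.span_singleton_le_iff_mem]
        exact h
      · right
        refine ⟨π, hπ, sup_le hle ?_, hgood, rfl⟩
        rw [Ideal.span_singleton_le_iff_mem]
        exact h

/-- index set for the universal family of relations. -/
abbrev JJ (wt : G → ℕ) (b : ℕ) : Type := {w : FreeMonoid G // 1 ≤ wW wt w ∧ wW wt w ≤ b}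

theorem univ_finite (hwt : ∀ i, 1 ≤ wt i) (b c : ℕ) (k : Type) [Field k] [Fintype (JJ wt b)]
    [DecidableEq (JJ wt b)] :
    {s : ℕ → ℕ | ∃ r : JJ wt b → MonoidAlgebra k (FreeMonoid G),
      (∀ j, r j ∈ Hom wt k 0 (wW wt j.1)) ∧ Good wt (fun j => wW wt j.1) r c ∧
      s = fun d => Module.finrank k (II wt (fun j => wW wt j.1) r 0 d)}.Finite := by
  let rP : JJ wt b → MonoidAlgebra (MvPolynomial (JJ wt b × JJ wt b) k) (FreeMonoid G) := fun j =>
    ∑ w : JJ wt b, if wW wt w.1 = wW wt j.1 then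
      MonoidAlgebra.single w.1 (MvPolynomial.X (j, w) : MvPolynomial (JJ wt b × JJ wt b) k) else 0
  have hrP : ∀ j, rP j ∈ Hom wt (MvPolynomial (JJ wt b × JJ wt b) k) 0 (wW wt j.1) := by
    intro j
    apply Submodule.sum_mem
    intro w _
    split_ifs with h
    · exact single_mem_Hom wt (by omega) _
    · exact Submodule.zero_mem _
  refine Set.Finite.subset (ptSer_finite hwt (fun j => j.2.1) rP hrP c k ⊥) ?_
  rintro s ⟨r, hr, hgood, rfl⟩
  let π : (MvPolynomial (JJ wt b × JJ wt b) k) →+* k := MvPolynomial.eval (fun p => (r p.1).coeff p.2.1)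
  have hπ : Function.Surjective π := fun x => ⟨MvPolynomial.C x, by simp [π]⟩
  have hmm : (fun j => mp π (rP j)) = r := by
    ext1 j
    ext w
    rw [mp_coeff]
    simp only [rP]
    rw [MonoidAlgebra.coeff_sum, Finsupp.finsetSum_apply, map_sum]
    by_cases hw : wW wt w = wW wt j.1
    · have hw' : 1 ≤ wW wt w ∧ wW wt w ≤ b := by rw [hw]; exact j.2
      rw [Finset.sum_eq_single (⟨w, hw'⟩ : JJ wt b)]
      · simp [hw, π]
      · intro v _ hv
        have : v.1 ≠ w := fun h => hv (Subtype.ext h)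
        split_ifs
        · simp [this]
        · simp
      · simp
    · rw [Finset.sum_eq_zero]
      · by_contra h
        have := hr j w (Ne.symm h)
        omega
      · intro v _
        split_ifs with h
        · have : v.1 ≠ w := fun h' => hw (by rw [← h', h])
          simp [this]
        · simp
  refine ⟨π, hπ, bot_le, ?_, ?_⟩ <;> rw [hmm]
  exact hgood

end Noeth
section Alg

variable {k : Type} [Field k] {R : Type} [Ring R] [Algebra k R]

/-- a connected grading with its projections. -/
structure Gr (S : ℤ → Submodule k R) (p : ℤ → R →ₗ[k] R) : Prop where
  mul : ∀ {i j : ℤ} {x y : R}, x ∈ S i → y ∈ S j → x * y ∈ S (i + j)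
  one : (1 : R) ∈ S 0
  zero : ∀ {x : R}, x ∈ S 0 → ∃ c : k, x = c • (1 : R)
  neg : ∀ {z : ℤ} {x : R}, z < 0 → x ∈ S z → x = 0
  p_mem : ∀ z x, p z x ∈ S z
  p_id : ∀ {z x}, x ∈ S z → p z x = x
  p_mul : ∀ {z t x y}, x ∈ S z → p t (x * y) = x * p (t - z) y

lemma Gr.mul' {S : ℤ → Submodule k R} {p : ℤ → R →ₗ[k] R} (hS : Gr S p) {i j z : ℤ} {x y : R}
    (hx : x ∈ S i) (hy : y ∈ S j) (h : i + j = z) : x * y ∈ S z := h ▸ hS.mul hx hy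

variable {G : Type} [Fintype G] [DecidableEq G]

/-- the map from the free algebra. -/
noncomputable def ph (k : Type) [Field k] {R : Type} [Ring R] [Algebra k R] (g : G → R) :
    MonoidAlgebra k (FreeMonoid G) →ₐ[k] R :=
  MonoidAlgebra.lift k R (FreeMonoid G) (FreeMonoid.lift g)

lemma ph_single (g : G → R) (w : FreeMonoid G) :
    ph k g (MonoidAlgebra.single w 1) = FreeMonoid.lift g w := by
  simp [ph]

lemma ph_X (g : G → R) (i : G) : ph k g (X k i) = g i := by
  rw [X, ph_single, FreeMonoid.lift_eval_of]

/-- generators of a connected graded algebra. -/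
structure Dat (wt : G → ℕ) (S : ℤ → Submodule k R) (p : ℤ → R →ₗ[k] R) (g : G → R) : Prop
    extends Gr S p where
  ne : (1 : R) ≠ 0
  hwt : ∀ i, 1 ≤ wt i
  g_mem : ∀ i, g i ∈ S (wt i)
  gen : ∀ d : ℕ, 1 ≤ d → ∀ x ∈ S d, ∃ v : G → R, (∀ i, v i ∈ S (d - wt i)) ∧ x = ∑ i, g i * v i

variable {wt : G → ℕ} {S : ℤ → Submodule k R} {p : ℤ → R →ₗ[k] R} {g : G → R}

lemma Hom_shift {O : Type} [CommRing O] {e d : ℕ} (h : e ≤ d) : Hom wt O e d = Hom wt O 0 (d - e) := by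
  ext f
  constructor
  · intro hf w hw
    have := hf w hw; omega
  · intro hf w hw
    have := hf w hw; omega

lemma Hom_bot {O : Type} [CommRing O] {e d : ℕ} (h : d < e) {f : MonoidAlgebra O (FreeMonoid G)}
    (hf : f ∈ Hom wt O e d) : f = 0 := by
  ext w
  by_contra hw
  have := hf w hw
  omega

namespace Dat

lemma ph_mem (h : Dat wt S p g) {e d : ℕ} {f : MonoidAlgebra k (FreeMonoid G)}
    (hf : f ∈ Hom wt k e d) : ph k g f ∈ S ((d : ℤ) - e) := by
  rw [Hom_eq_span] at hf
  induction hf using Submodule.span_induction with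
  | mem f hf =>
    obtain ⟨w, hw, rfl⟩ := hf
    rw [ph_single]
    have key : ∀ w : FreeMonoid G, FreeMonoid.lift g w ∈ S (wW wt w) := by
      intro w
      induction w using FreeMonoid.inductionOn' with
      | one => simpa using h.one
      | of_mul i w ih =>
        rw [map_mul, FreeMonoid.lift_eval_of]
        exact h.mul' (h.g_mem i) ih (by simp)
    have e1 : (d : ℤ) - e = wW wt w := by omega
    rw [e1]; exact key w
  | zero => rw [map_zero]; exact Submodule.zero_mem _
  | add x y _ _ hx hy => rw [map_add]; exact Submodule.add_mem _ hx hy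
  | smul c x _ hx => rw [map_smul]; exact Submodule.smul_mem _ _ hx

lemma ph_surj0 (h : Dat wt S p g) (d : ℕ) : ∀ x ∈ S d, ∃ f ∈ Hom wt k 0 d, ph k g f = x := by
  induction d using Nat.strong_induction_on with
  | _ d ih =>
  intro x hx
  rcases Nat.eq_zero_or_pos d with rfl | hd
  · obtain ⟨c, rfl⟩ := h.zero hx
    refine ⟨c • MonoidAlgebra.single 1 1, Submodule.smul_mem _ _ (single_mem_Hom wt (by simp) 1), ?_⟩
    rw [map_smul, ph_single, map_one]
  · obtain ⟨v, hv, rfl⟩ := h.gen d hd x hx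
    have : ∀ i, ∃ f ∈ Hom wt k (wt i) d, ph k g f = v i := by
      intro i
      by_cases hi : wt i ≤ d
      · rw [Hom_shift hi]
        apply ih _ (by have := h.hwt i; omega)
        have := hv i
        rwa [← Nat.cast_sub hi] at this
      · exact ⟨0, Submodule.zero_mem _, by rw [map_zero, h.neg (by omega) (hv i)]⟩
    choose f hf hfv using this
    refine ⟨∑ i, X k i * f i, Submodule.sum_mem _ fun i _ => Hom_mul wt (X_mem wt i) (hf i), ?_⟩
    rw [map_sum]
    simp only [map_mul, ph_X, hfv]

lemma ph_surj (h : Dat wt S p g) {e d : ℕ} {x : R} (hx : x ∈ S ((d : ℤ) - e)) :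
    ∃ f ∈ Hom wt k e d, ph k g f = x := by
  by_cases hi : e ≤ d
  · rw [Hom_shift hi]
    apply h.ph_surj0
    rwa [← Nat.cast_sub hi] at hx
  · exact ⟨0, Submodule.zero_mem _, by rw [map_zero, h.neg (by omega) hx]⟩

end Dat

/-- choice of relations in degrees `≤ b`. -/
lemma exists_rel (wt : G → ℕ) (g : G → R) (b : ℕ) :
    ∃ r : JJ wt b → MonoidAlgebra k (FreeMonoid G),
      (∀ j, r j ∈ Hom wt k 0 (wW wt j.1)) ∧ (∀ j, ph k g (r j) = 0) ∧
      ∀ e, 1 ≤ e → e ≤ b → ∀ x ∈ Hom wt k 0 e, ph k g x = 0 →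
        x ∈ Submodule.span k {y | ∃ j, wW wt j.1 = e ∧ y = r j} := by
  let K : ℕ → Submodule k (MonoidAlgebra k (FreeMonoid G)) := fun e =>
    Hom wt k 0 e ⊓ LinearMap.ker (ph k g).toLinearMap
  have : ∀ e, ∃ q : MonoidAlgebra k (FreeMonoid G) →ₗ[k] K e, ∀ x : K e, q x = x := by
    intro e
    obtain ⟨q, hq⟩ := LinearMap.exists_leftInverse_of_injective (K e).subtype (by simp)
    exact ⟨q, fun x => LinearMap.congr_fun hq x⟩
  choose q hq using this
  refine ⟨fun j => q (wW wt j.1) (MonoidAlgebra.single j.1 1), fun j => ?_, fun j => ?_, ?_⟩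
  · exact (q (wW wt j.1) (MonoidAlgebra.single j.1 1)).2.1
  · exact (q (wW wt j.1) (MonoidAlgebra.single j.1 1)).2.2
  · intro e he hb x hx hx0
    have h1 : ∀ y ∈ Hom wt k 0 e, (q e y : MonoidAlgebra k (FreeMonoid G)) ∈
        Submodule.span k {y | ∃ j : JJ wt b, wW wt j.1 = e ∧
          y = (q (wW wt j.1) (MonoidAlgebra.single j.1 1)).1} := by
      intro y hy
      rw [Hom_eq_span] at hy
      induction hy using Submodule.span_induction with
      | mem f hf =>
        obtain ⟨w, hw, rfl⟩ := hf
        have hw' : wW wt w = e := by omega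
        apply Submodule.subset_span
        refine ⟨⟨w, by omega⟩, hw', ?_⟩
        subst hw'; rfl
      | zero => simp
      | add x y _ _ hx hy => rw [map_add]; exact Submodule.add_mem _ hx hy
      | smul c x _ hx => rw [map_smul]; exact Submodule.smul_mem _ _ hx
    have h2 := h1 x hx
    have h3 := congrArg Subtype.val (hq e ⟨x, hx, hx0⟩)
    rw [h3] at h2
    exact h2

variable {J : Type} [Fintype J] [DecidableEq J]

/-- generators and relations. -/
structure Rel (wt : G → ℕ) (S : ℤ → Submodule k R) (p : ℤ → R →ₗ[k] R) (g : G → R)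
    (deg : J → ℕ) (r : J → MonoidAlgebra k (FreeMonoid G)) (b : ℕ)
    {m : ℕ} (hG : Fin m → G → R) (e : Fin m → ℤ) : Prop
    extends Dat wt S p g where
  hdeg : ∀ j, 1 ≤ deg j
  hdegb : ∀ j, deg j ≤ b
  r_mem : ∀ j, r j ∈ Hom wt k 0 (deg j)
  r_zero : ∀ j, ph k g (r j) = 0
  r_gen : ∀ d, 1 ≤ d → d ≤ b → ∀ x ∈ Hom wt k 0 d, ph k g x = 0 →
        x ∈ Submodule.span k {y | ∃ j, deg j = d ∧ y = r j}
  e_le : ∀ l, e l ≤ b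
  h_mem : ∀ l i, hG l i ∈ S (e l - wt i)
  h_sol : ∀ l, ∑ i, g i * hG l i = 0
  h_gen : ∀ v : G → R, ∑ i, g i * v i = 0 → ∃ cf : Fin m → R, ∀ i, v i = ∑ l, hG l i * cf l

variable {deg : J → ℕ} {r : J → MonoidAlgebra k (FreeMonoid G)} {b : ℕ}
    {m : ℕ} {hG : Fin m → G → R} {e : Fin m → ℤ}

/-- the relations as columns over the algebra. -/
noncomputable def hh (g : G → R) (r : J → MonoidAlgebra k (FreeMonoid G)) (j : J) (i : G) : R :=
  ph k g (D i (r j))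

namespace Rel

lemma hh_mem (h : Rel wt S p g deg r b hG e) (j : J) (i : G) :
    hh g r j i ∈ S ((deg j : ℤ) - wt i) := by
  have := h.ph_mem (D_mem wt i (h.r_mem j))
  rw [hh]
  simpa using this

lemma hh_sol (h : Rel wt S p g deg r b hG e) (j : J) : ∑ i, g i * hh g r j i = 0 := by
  rw [← h.r_zero j]
  conv_rhs => rw [sum_X_D wt (h.hdeg j) (h.r_mem j)]
  rw [map_sum]
  simp only [map_mul, ph_X, hh]

lemma low (h : Rel wt S p g deg r b hG e) {z : ℤ} (hz : z ≤ b) {v : G → R}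
    (hv : ∀ i, v i ∈ S (z - wt i)) (hsol : ∑ i, g i * v i = 0) :
    ∃ a : J → R, (∀ j, a j ∈ S (z - deg j)) ∧ ∀ i, v i = ∑ j, hh g r j i * a j := by
  by_cases hz0 : z ≤ 0
  · refine ⟨0, fun j => Submodule.zero_mem _, fun i => ?_⟩
    rw [h.neg (by have := h.hwt i; omega) (hv i)]
    simp
  · obtain ⟨d, rfl⟩ := Int.eq_ofNat_of_zero_le (show 0 ≤ z by omega)
    choose f hf hfv using fun i => h.ph_surj (hv i)
    have hx : ∑ i, X k i * f i ∈ Hom wt k 0 d :=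
      Submodule.sum_mem _ fun i _ => Hom_mul wt (X_mem wt i) (hf i)
    have hx0 : ph k g (∑ i, X k i * f i) = 0 := by
      rw [map_sum]
      simp only [map_mul, ph_X, hfv]
      exact hsol
    have hsp := h.r_gen d (by omega) (by omega) _ hx hx0
    have key : ∀ y ∈ Submodule.span k {y | ∃ j, deg j = d ∧ y = r j},
        ∃ a : J → R, (∀ j, a j ∈ S ((d : ℤ) - deg j)) ∧
          ∀ i, ph k g (D i y) = ∑ j, hh g r j i * a j := by
      intro y hy
      induction hy using Submodule.span_induction with
      | mem y hy =>
        obtain ⟨j, hj, rfl⟩ := hy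
        refine ⟨Pi.single j 1, fun j' => ?_, fun i => ?_⟩
        · by_cases hjj : j' = j
          · subst hjj
            rw [Pi.single_eq_same, hj, sub_self]; exact h.one
          · rw [Pi.single_eq_of_ne hjj]; exact Submodule.zero_mem _
        · rw [Finset.sum_eq_single j]
          · simp [hh]
          · intro j' _ hj; rw [Pi.single_eq_of_ne hj, mul_zero]
          · simp
      | zero => exact ⟨0, fun j => Submodule.zero_mem _, by simp⟩
      | add x y _ _ hx hy =>
        obtain ⟨a, ha, ha'⟩ := hx
        obtain ⟨a2, ha2, ha2'⟩ := hy
        refine ⟨a + a2, fun j => Submodule.add_mem _ (ha j) (ha2 j), fun i => ?_⟩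
        rw [map_add, map_add, ha', ha2']
        simp only [Pi.add_apply, mul_add, Finset.sum_add_distrib]
      | smul c x _ hx =>
        obtain ⟨a, ha, ha'⟩ := hx
        refine ⟨c • a, fun j => Submodule.smul_mem _ _ (ha j), fun i => ?_⟩
        rw [map_smul, map_smul, ha']
        simp only [Pi.smul_apply, mul_smul_comm, ← Finset.smul_sum]
    obtain ⟨a, ha, ha'⟩ := key _ hsp
    refine ⟨a, ha, fun i => ?_⟩
    rw [← ha' i, D_sum_X, hfv]

lemma exists_a (h : Rel wt S p g deg r b hG e) : ∃ a : Fin m → J → R,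
    (∀ l j, a l j ∈ S (e l - deg j)) ∧ ∀ l i, hG l i = ∑ j, hh g r j i * a l j := by
  choose a ha ha' using fun l => h.low (h.e_le l) (h.h_mem l) (h.h_sol l)
  exact ⟨a, ha, ha'⟩

lemma gen_sol (h : Rel wt S p g deg r b hG e) {z : ℤ} {v : G → R}
    (hv : ∀ i, v i ∈ S (z - wt i)) (hsol : ∑ i, g i * v i = 0) :
    ∃ a : J → R, (∀ j, a j ∈ S (z - deg j)) ∧ ∀ i, v i = ∑ j, hh g r j i * a j := by
  obtain ⟨a, ha, ha'⟩ := h.exists_a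
  obtain ⟨cf, hcf⟩ := h.h_gen v hsol
  refine ⟨fun j => ∑ l, a l j * p (z - e l) (cf l), fun j => ?_, fun i => ?_⟩
  · exact Submodule.sum_mem _ fun l _ => h.mul' (ha l j) (h.p_mem _ _) (by ring)
  · have h1 : v i = ∑ l, hG l i * p (z - e l) (cf l) := by
      rw [← h.p_id (hv i), hcf i, map_sum]
      apply Finset.sum_congr rfl
      intro l _
      rw [h.p_mul (h.h_mem l i)]
      congr 2
      ring_nf
    rw [h1]
    simp only [ha', Finset.sum_mul, Finset.mul_sum, mul_assoc]
    rw [Finset.sum_comm]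

lemma ph_II (h : Rel wt S p g deg r b hG e) {u d : ℕ} {x : MonoidAlgebra k (FreeMonoid G)}
    (hx : x ∈ II wt deg r u d) : ph k g x = 0 := by
  induction hx using Submodule.span_induction with
  | mem x hx =>
    obtain ⟨u, j, v, -, rfl⟩ := hx
    rw [map_mul, map_mul, h.r_zero, mul_zero, zero_mul]
  | zero => simp
  | add x y _ _ hx hy => rw [map_add, hx, hy, add_zero]
  | smul c x _ hx => rw [map_smul, hx, smul_zero]

lemma ker0 (h : Rel wt S p g deg r b hG e) (d : ℕ) :
    ∀ x ∈ Hom wt k 0 d, ph k g x = 0 → x ∈ II wt deg r 0 d := by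
  induction d using Nat.strong_induction_on with
  | _ d ih =>
  intro x hx hx0
  rcases Nat.eq_zero_or_pos d with rfl | hd
  · have hw : ∀ w : FreeMonoid G, wW wt w + 0 = 0 → w = 1 := by
      intro w
      induction w using FreeMonoid.casesOn with
      | one => intro; rfl
      | of_mul i w => intro h1; have := h.hwt i; simp at h1; omega
    have hxe : ∃ c : k, x = c • MonoidAlgebra.single 1 1 := by
      rw [Hom_eq_span] at hx
      have h2 : x ∈ Submodule.span k {(MonoidAlgebra.single 1 1 : MonoidAlgebra k (FreeMonoid G))} := by
        refine Submodule.span_mono ?_ hx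
        rintro _ ⟨w, h1, rfl⟩
        rw [hw w h1]; rfl
      obtain ⟨c, hc⟩ := Submodule.mem_span_singleton.mp h2
      exact ⟨c, hc.symm⟩
    obtain ⟨c, rfl⟩ := hxe
    rw [map_smul, ph_single, map_one] at hx0
    rcases smul_eq_zero.mp hx0 with hc | hc
    · rw [hc, zero_smul]; exact Submodule.zero_mem _
    · exact absurd hc h.ne
  · have hxd := sum_X_D wt hd hx
    obtain ⟨a, ha, ha'⟩ := h.gen_sol (z := d) (v := fun i => ph k g (D i x))
      (fun i => by simpa using h.ph_mem (D_mem wt i hx))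
      (by rw [hxd, map_sum] at hx0; simpa only [map_mul, ph_X] using hx0)
    choose α hα hα' using fun j => h.ph_surj (ha j)
    have hy : ∀ i, D i x - ∑ j, D i (r j) * α j ∈ II wt deg r (wt i) d := by
      intro i
      have hy1 : D i x - ∑ j, D i (r j) * α j ∈ Hom wt k (wt i) d := by
        apply Submodule.sub_mem
        · exact D_mem wt i hx
        · exact Submodule.sum_mem _ fun j _ => Hom_mul wt (D_mem wt i (h.r_mem j)) (hα j)
      have hy2 : ph k g (D i x - ∑ j, D i (r j) * α j) = 0 := by
        rw [map_sub, ha' i, map_sum]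
        simp only [map_mul, hα', hh, sub_self]
      by_cases hi : wt i ≤ d
      · rw [II_eq hi]
        rw [Hom_shift hi] at hy1
        exact ih _ (by have := h.hwt i; omega) _ hy1 hy2
      · rw [Hom_bot (by omega) hy1]; exact Submodule.zero_mem _
    have hxx : x = ∑ i, X k i * (D i x - ∑ j, D i (r j) * α j) + ∑ j, r j * α j := by
      have h2 : ∑ j, r j * α j = ∑ i, X k i * ∑ j, D i (r j) * α j := by
        simp only [Finset.mul_sum]
        rw [Finset.sum_comm]
        apply Finset.sum_congr rfl
        intro j _
        conv_lhs => rw [sum_X_D wt (h.hdeg j) (h.r_mem j)]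
        rw [Finset.sum_mul]
        simp only [mul_assoc]
      rw [h2, ← Finset.sum_add_distrib]
      simp only [← mul_add, sub_add_cancel]
      exact hxd
    rw [hxx]
    exact Submodule.add_mem _ (Submodule.sum_mem _ fun i _ => X_mul_mem i (hy i))
      (Submodule.sum_mem _ fun j _ => r_mul_mem j (hα j))

lemma ker (h : Rel wt S p g deg r b hG e) {u d : ℕ} {x : MonoidAlgebra k (FreeMonoid G)}
    (hx : x ∈ Hom wt k u d) (hx0 : ph k g x = 0) : x ∈ II wt deg r u d := by
  by_cases hi : u ≤ d
  · rw [II_eq hi]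
    rw [Hom_shift hi] at hx
    exact h.ker0 _ x hx hx0
  · rw [Hom_bot (by omega) hx]; exact Submodule.zero_mem _

/-- homogeneous syzygies of `hh` over the algebra. -/
def SyzR (S : ℤ → Submodule k R) (g : G → R) (deg : J → ℕ)
    (r : J → MonoidAlgebra k (FreeMonoid G)) (z : ℤ) : Set (J → R) :=
  {s | (∀ j, s j ∈ S (z - deg j)) ∧ ∀ i, ∑ j, hh g r j i * s j = 0}

/-- span of the low degree syzygies. -/
def TT (S : ℤ → Submodule k R) (g : G → R) (deg : J → ℕ)
    (r : J → MonoidAlgebra k (FreeMonoid G)) (c d : ℕ) : Submodule k (J → R) :=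
  Submodule.span k {t | ∃ z : ℕ, z ≤ c ∧ ∃ s ∈ SyzR S g deg r z, ∃ q ∈ S ((d : ℤ) - z),
    t = fun j => s j * q}

lemma mem_TT (h : Rel wt S p g deg r b hG e) {c d : ℕ} {z : ℤ} (hz : z ≤ c) {s : J → R}
    (hs : s ∈ SyzR S g deg r z) {q : R} (hq : q ∈ S ((d : ℤ) - z)) :
    (fun j => s j * q) ∈ TT S g deg r c d := by
  by_cases hz0 : 0 ≤ z
  · obtain ⟨z, rfl⟩ := Int.eq_ofNat_of_zero_le hz0
    exact Submodule.subset_span ⟨z, by omega, s, hs, q, hq, rfl⟩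
  · have : (fun j => s j * q) = 0 := by
      ext1 j
      rw [h.neg (by omega) (hs.1 j)]
      simp
    rw [this]; exact Submodule.zero_mem _

lemma syz_low (h : Rel wt S p g deg r b hG e) {N : Type} [Fintype N] {H : Fin m → N → R}
    {c c0 : ℕ} (hc : c ≤ c0) (hb : b ≤ c0)
    (ι : G → N) (hHG : ∀ l i, H l (ι i) = hG l i)
    (hgen : ∀ w : Fin m → R, (∀ i, ∑ l, H l i * w l = 0) →
      w ∈ Submodule.span Rᵐᵒᵖ {u : Fin m → R | (∀ i, ∑ l, H l i * u l = 0) ∧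
        ∃ z ≤ (c : ℤ), ∀ l, u l ∈ S (z - e l)})
    (E : J → N → R) (hE : ∀ j i, E j (ι i) = hh g r j i)
    (hE0 : ∀ n, (∀ j, E j n = 0) ∨ ∃ i, n = ι i)
    (bb : J → Fin m → R) (hbb : ∀ j l, bb j l ∈ S (deg j - e l))
    (hEb : ∀ j n, E j n = ∑ l, H l n * bb j l)
    {d : ℕ} {v : J → R} (hv : v ∈ SyzR S g deg r d) : v ∈ TT S g deg r c0 d := by
  obtain ⟨a, ha, ha'⟩ := h.exists_a
  obtain ⟨hv1, hv2⟩ := hv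
  let w : Fin m → R := fun l => ∑ j, bb j l * v j
  have hw1 : ∀ l, w l ∈ S (d - e l) := fun l =>
    Submodule.sum_mem _ fun j _ => h.mul' (hbb j l) (hv1 j) (by ring)
  have hw2 : ∀ n, ∑ l, H l n * w l = 0 := by
    intro n
    have : ∑ l, H l n * w l = ∑ j, E j n * v j := by
      simp only [w, hEb, Finset.mul_sum, Finset.sum_mul, mul_assoc]
      rw [Finset.sum_comm]
    rw [this]
    rcases hE0 n with h0 | ⟨i, rfl⟩
    · simp [h0]
    · simp only [hE]; exact hv2 i
  have key : ∀ x ∈ Submodule.span Rᵐᵒᵖ {u : Fin m → R | (∀ i, ∑ l, H l i * u l = 0) ∧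
        ∃ z ≤ (c : ℤ), ∀ l, u l ∈ S (z - e l)}, ∀ q : R,
        (fun j => ∑ l, a l j * p (d - e l) (x l * q)) ∈ TT S g deg r c0 d := by
    intro x hx
    induction hx using Submodule.span_induction with
    | mem u hu =>
      obtain ⟨hu1, z, hz, hu2⟩ := hu
      intro q
      have h1 : (fun j => ∑ l, a l j * p (d - e l) (u l * q)) =
          fun j => (∑ l, a l j * u l) * p (d - z) q := by
        ext1 j
        rw [Finset.sum_mul]
        apply Finset.sum_congr rfl
        intro l _
        rw [h.p_mul (hu2 l), mul_assoc]
        congr 3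
        ring_nf
      rw [h1]
      refine h.mem_TT (z := z) (by omega) (s := fun j => ∑ l, a l j * u l) ⟨fun j => ?_, fun i => ?_⟩
        (h.p_mem _ _)
      · exact Submodule.sum_mem _ fun l _ => h.mul' (ha l j) (hu2 l) (by ring)
      · rw [← hu1 (ι i)]
        simp only [hHG, ha', Finset.mul_sum, Finset.sum_mul, mul_assoc]
        rw [Finset.sum_comm]
    | zero => intro q; simp only [Pi.zero_apply, zero_mul, map_zero, mul_zero,
        Finset.sum_const_zero]; exact Submodule.zero_mem _
    | add x y _ _ hx hy =>
      intro q
      have := Submodule.add_mem _ (hx q) (hy q)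
      convert this using 1
      ext1 j
      simp only [Pi.add_apply, add_mul, map_add, mul_add, Finset.sum_add_distrib]
    | smul s x _ hx =>
      intro q
      have := hx (unop s * q)
      convert this using 1
      ext1 j
      apply Finset.sum_congr rfl
      intro l _
      rw [Pi.smul_apply, ← op_unop s, op_smul_eq_mul, unop_op, mul_assoc]
  have h1 := key w (hgen w hw2) 1
  have h1' : (fun j => ∑ l, a l j * w l) ∈ TT S g deg r c0 d := by
    convert h1 using 1
    ext1 j
    apply Finset.sum_congr rfl
    intro l _
    rw [mul_one, h.p_id (hw1 l)]
  have h2 : ∀ j0, (fun j => ((if j = j0 then 1 else 0) - ∑ l, a l j * bb j0 l) * v j0) ∈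
      TT S g deg r c0 d := by
    intro j0
    refine h.mem_TT (z := deg j0) (by have := h.hdegb j0; omega)
      (s := fun j => (if j = j0 then 1 else 0) - ∑ l, a l j * bb j0 l)
      ⟨fun j => ?_, fun i => ?_⟩ (hv1 j0)
    · apply Submodule.sub_mem
      · split_ifs with hj
        · rw [hj, sub_self]; exact h.one
        · exact Submodule.zero_mem _
      · exact Submodule.sum_mem _ fun l _ => h.mul' (ha l j) (hbb j0 l) (by ring)
    · simp only [mul_sub, Finset.sum_sub_distrib, mul_ite, mul_one, mul_zero,
        Finset.sum_ite_eq', Finset.mem_univ, if_true]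
      rw [← hE, hEb, sub_eq_zero]
      simp only [hHG, ha', Finset.mul_sum, Finset.sum_mul, mul_assoc]
      rw [Finset.sum_comm]
  have h3 : v = (fun j => ∑ l, a l j * w l) +
      ∑ j0, (fun j => ((if j = j0 then 1 else 0) - ∑ l, a l j * bb j0 l) * v j0) := by
    ext1 j
    rw [Pi.add_apply, Finset.sum_apply]
    simp only [sub_mul, Finset.sum_sub_distrib, ite_mul, one_mul, zero_mul,
      Finset.sum_ite_eq, Finset.mem_univ, if_true]
    simp only [w, Finset.mul_sum, Finset.sum_mul, mul_assoc]
    rw [Finset.sum_comm]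
    abel
  rw [h3]
  exact Submodule.add_mem _ h1' (Submodule.sum_mem _ fun j _ => h2 j)

lemma good (h : Rel wt S p g deg r b hG e) {c0 : ℕ}
    (hT : ∀ d : ℕ, ∀ v ∈ SyzR S g deg r d, v ∈ TT S g deg r c0 d) : Good wt deg r c0 := by
  intro d f hf
  obtain ⟨hf1, y, hy, hfy⟩ := hf
  have hv : (fun j => ph k g (f j)) ∈ SyzR S g deg r d := by
    refine ⟨fun j => h.ph_mem (hf1 j), fun i => ?_⟩
    have h1 := congrArg (D i) hfy
    rw [D_sum_X, map_sum] at h1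
    rw [← h.ph_II (hy i), ← h1, map_sum]
    apply Finset.sum_congr rfl
    intro j _
    rw [D_mul wt i (h.hdeg j) (h.r_mem j), map_mul, hh]
  have key : ∀ t ∈ TT S g deg r c0 d, ∃ F ∈ Submodule.span k
    ({t | ∀ j, t j ∈ II wt deg r (deg j) d} ∪
      {t | ∃ m ≤ c0, ∃ s ∈ Syz wt deg r m, ∃ q ∈ Hom wt k m d, t = fun j => s j * q}),
      (∀ j, F j ∈ Hom wt k (deg j) d) ∧ ∀ j, ph k g (F j) = t j := by
    intro t ht
    induction ht using Submodule.span_induction with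
    | mem t ht =>
      obtain ⟨z, hz, s, hs, q, hq, rfl⟩ := ht
      choose σ hσ hσ' using fun j => h.ph_surj (hs.1 j)
      obtain ⟨Q, hQ, rfl⟩ := h.ph_surj hq
      refine ⟨fun j => σ j * Q, Submodule.subset_span (Or.inr ⟨z, hz, σ, ?_, Q, hQ, rfl⟩),
        fun j => Hom_mul wt (hσ j) hQ, fun j => by rw [map_mul, hσ']⟩
      refine ⟨hσ, fun i => ∑ j, D i (r j) * σ j, fun i => ?_, ?_⟩
      · apply h.ker
        · exact Submodule.sum_mem _ fun j _ => Hom_mul wt (D_mem wt i (h.r_mem j)) (hσ j)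
        · rw [← hs.2 i, map_sum]
          simp only [map_mul, hσ', hh]
      · simp only [Finset.mul_sum]
        rw [Finset.sum_comm]
        apply Finset.sum_congr rfl
        intro j _
        conv_lhs => rw [sum_X_D wt (h.hdeg j) (h.r_mem j)]
        rw [Finset.sum_mul]
        simp only [mul_assoc]
    | zero => exact ⟨0, Submodule.zero_mem _, fun j => Submodule.zero_mem _, by simp⟩
    | add x y _ _ hx hy =>
      obtain ⟨F, hF, hF1, hF2⟩ := hx
      obtain ⟨F', hF', hF1', hF2'⟩ := hy
      exact ⟨F + F', Submodule.add_mem _ hF hF', fun j => Submodule.add_mem _ (hF1 j) (hF1' j),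
        fun j => by simp [hF2, hF2']⟩
    | smul c x _ hx =>
      obtain ⟨F, hF, hF1, hF2⟩ := hx
      exact ⟨c • F, Submodule.smul_mem _ _ hF, fun j => Submodule.smul_mem _ _ (hF1 j),
        fun j => by simp [hF2]⟩
  obtain ⟨F, hF, hF1, hF2⟩ := key _ (hT d _ hv)
  have h2 : f = F + (f - F) := by abel
  rw [h2]
  refine Submodule.add_mem _ hF (Submodule.subset_span (Or.inl fun j => ?_))
  apply h.ker
  · exact Submodule.sub_mem _ (hf1 j) (hF1 j)
  · rw [Pi.sub_apply, map_sub, hF2, sub_self]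

lemma finrank_eq (h : Rel wt S p g deg r b hG e) (d : ℕ) :
    Module.finrank k (S d) = Module.finrank k (Hom wt k 0 d) -
      Module.finrank k (II wt deg r 0 d) := by
  have hfin : FiniteDimensional k (Hom wt k 0 d) := by
    apply Module.Finite.iff_fg.mpr
    rw [Hom_eq_span]
    apply Submodule.fg_span
    refine Set.Finite.subset ((finite_words wt h.hwt d).image
      (fun w => MonoidAlgebra.single w (1 : k))) ?_
    rintro _ ⟨w, hw, rfl⟩
    exact ⟨w, by simp only [Set.mem_ofPred_eq]; omega, rfl⟩
  let L := (ph k g).toLinearMap.domRestrict (Hom wt k 0 d)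
  have hL : ∀ x, L x = ph k g x := fun x => rfl
  have h1 := L.finrank_range_add_finrank_ker
  have h2 : LinearMap.range L = S d := by
    ext x
    constructor
    · rintro ⟨f, rfl⟩
      rw [hL]
      simpa using h.ph_mem f.2
    · intro hx
      obtain ⟨f, hf, rfl⟩ := h.ph_surj0 d x hx
      exact ⟨⟨f, hf⟩, rfl⟩
  have h3 : LinearMap.ker L = (II wt deg r 0 d).submoduleOf (Hom wt k 0 d) := by
    ext x
    change ph k g x = 0 ↔ (x : MonoidAlgebra k (FreeMonoid G)) ∈ II wt deg r 0 d
    exact ⟨fun hx => h.ker x.2 hx, fun hx => h.ph_II hx⟩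
  have h4 := (Submodule.submoduleOfEquivOfLe (II_le_Hom h.r_mem 0 d)).finrank_eq
  rw [h3, h2, h4] at h1
  omega

end Rel

end Alg
section Final

open NCG

variable {k : Type} [Field k] {R : Type} [Ring R] [Algebra k R]

lemma grZ_nat (𝒜 : ℕ → Submodule k R) (d : ℕ) : grZ k R 𝒜 (d : ℤ) = 𝒜 d := by
  simp [grZ]

lemma grZ_neg (𝒜 : ℕ → Submodule k R) {z : ℤ} (h : z < 0) : grZ k R 𝒜 z = ⊥ := by
  simp [grZ, h]

lemma exists_gr {𝒜 : ℕ → Submodule k R} (h : IsConnAlg k R 𝒜) :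
    ∃ p : ℤ → R →ₗ[k] R, Gr (grZ k R 𝒜) p := by
  obtain ⟨hmul, hdirect, h0⟩ := h
  have hone : (1 : R) ∈ 𝒜 0 := by rw [h0]; exact Submodule.mem_span_singleton_self _
  letI : DirectSum.Decomposition 𝒜 := hdirect.chooseDecomposition 𝒜
  letI : GradedAlgebra 𝒜 :=
    { one_mem := hone
      mul_mem := fun i j x y hx hy => hmul i j x hx y hy }
  have hneg : ∀ {z : ℤ} {x : R}, z < 0 → x ∈ grZ k R 𝒜 z → x = 0 := by
    intro z x hz hx
    rw [grZ_neg 𝒜 hz] at hx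
    simpa using hx
  refine ⟨fun z => if 0 ≤ z then GradedAlgebra.proj 𝒜 z.toNat else 0, ?_⟩
  have hp0 : ∀ (n : ℕ) x, (if 0 ≤ (n : ℤ) then GradedAlgebra.proj 𝒜 (n : ℤ).toNat else 0) x =
      ((DirectSum.decompose 𝒜 x) n : R) := by
    intro n x
    rw [if_pos (by omega), GradedAlgebra.proj_apply, Int.toNat_natCast]
  have hp1 : ∀ (z : ℤ) (x : R), z < 0 →
      (if 0 ≤ z then GradedAlgebra.proj 𝒜 z.toNat else 0) x = 0 := by
    intro z x hz
    rw [if_neg (by omega)]; rfl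
  constructor
  · intro i j x y hx hy
    by_cases hi : i < 0
    · rw [hneg hi hx, zero_mul]; exact Submodule.zero_mem _
    by_cases hj : j < 0
    · rw [hneg hj hy, mul_zero]; exact Submodule.zero_mem _
    obtain ⟨i, rfl⟩ := Int.eq_ofNat_of_zero_le (show 0 ≤ i by omega)
    obtain ⟨j, rfl⟩ := Int.eq_ofNat_of_zero_le (show 0 ≤ j by omega)
    rw [grZ_nat] at hx hy
    rw [← Nat.cast_add, grZ_nat]
    exact hmul i j x hx y hy
  · exact (grZ_nat 𝒜 0).symm ▸ hone
  · intro x hx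
    have hx' : x ∈ 𝒜 0 := (grZ_nat 𝒜 0) ▸ hx
    rw [h0] at hx'
    obtain ⟨c, hc⟩ := Submodule.mem_span_singleton.mp hx'
    exact ⟨c, hc.symm⟩
  · exact hneg
  · intro z x
    by_cases hz : z < 0
    · rw [hp1 z x hz]; exact Submodule.zero_mem _
    · obtain ⟨z, rfl⟩ := Int.eq_ofNat_of_zero_le (show 0 ≤ z by omega)
      rw [hp0, grZ_nat]
      exact (DirectSum.decompose 𝒜 x z).2
  · intro z x hx
    by_cases hz : z < 0
    · rw [hp1 z x hz, hneg hz hx]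
    · obtain ⟨z, rfl⟩ := Int.eq_ofNat_of_zero_le (show 0 ≤ z by omega)
      rw [grZ_nat] at hx
      rw [hp0, DirectSum.decompose_of_mem_same 𝒜 hx]
  · intro z t x y hx
    by_cases hz : z < 0
    · rw [hneg hz hx, zero_mul, map_zero, zero_mul]
    obtain ⟨z, rfl⟩ := Int.eq_ofNat_of_zero_le (show 0 ≤ z by omega)
    rw [grZ_nat] at hx
    by_cases ht : t < 0
    · rw [hp1 t _ ht, hp1 _ _ (by omega), mul_zero]
    obtain ⟨t, rfl⟩ := Int.eq_ofNat_of_zero_le (show 0 ≤ t by omega)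
    rw [hp0]
    by_cases hzt : z ≤ t
    · rw [← Nat.cast_sub hzt, hp0, DirectSum.coe_decompose_mul_of_left_mem_of_le 𝒜 hx hzt]
    · rw [hp1 _ _ (by omega), mul_zero, DirectSum.coe_decompose_mul_of_left_mem_of_not_le 𝒜 hx hzt]

lemma sum_restrict {n : ℕ} (P : Fin n → Prop) [DecidablePred P] (F : Fin n → R)
    (hF : ∀ i, ¬ P i → F i = 0) : ∑ i, F i = ∑ i : {i // P i}, F i.1 := by
  rw [← Finset.sum_filter_of_ne (p := P) (fun x _ hx => by by_contra h; exact hx (hF x h))]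
  exact Finset.sum_subtype _ (by simp) F

lemma span_op {n : ℕ} {M : Type} [AddCommGroup M] [Module Rᵐᵒᵖ M] {v : Fin n → M} {x : M}
    (hx : x ∈ Submodule.span Rᵐᵒᵖ (Set.range v)) : ∃ c : Fin n → R, x = ∑ i, op (c i) • v i := by
  rw [Submodule.mem_span_range_iff_exists_fun] at hx
  obtain ⟨c, rfl⟩ := hx
  exact ⟨fun i => unop (c i), by simp⟩

lemma aug_zero {𝒜 : ℕ → Submodule k R} {p : ℤ → R →ₗ[k] R} (hS : Gr (grZ k R 𝒜) p)
    {x : R} (hx : x ∈ aug k R 𝒜) : ∀ q, p 0 (x * q) = 0 := by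
  rw [aug] at hx
  induction hx using Submodule.span_induction with
  | mem x hx =>
    intro q
    simp only [Set.mem_iUnion] at hx
    obtain ⟨i, hi, hx⟩ := hx
    have hx' : x ∈ grZ k R 𝒜 (i : ℤ) := by rw [grZ_nat]; exact hx
    rw [hS.p_mul hx', hS.neg (by omega) (hS.p_mem _ q), mul_zero]
  | zero => intro q; simp
  | add x y _ _ hx hy => intro q; rw [add_mul, map_add, hx, hy, add_zero]
  | smul c x _ hx =>
    intro q
    rw [← op_unop c, op_smul_eq_mul, mul_assoc, hx]

/-- restricted weights. -/
abbrev wtG {n : ℕ} (dg : Fin n → ℕ) : {i : Fin n // 1 ≤ dg i} → ℕ := fun i => dg i.1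

lemma wtG_pos {n : ℕ} (dg : Fin n → ℕ) (i : {i : Fin n // 1 ≤ dg i}) : 1 ≤ wtG dg i := i.2

noncomputable instance {n : ℕ} (dg : Fin n → ℕ) (b : ℕ) : Fintype (JJ (wtG dg) b) :=
  Set.Finite.fintype (s := {w | 1 ≤ wW (wtG dg) w ∧ wW (wtG dg) w ≤ b})
    ((finite_words (wtG dg) (wtG_pos dg) b).subset fun _ hw => hw.2)

/-- the possible Hilbert series for given generator degrees. -/
noncomputable def Ser (k : Type) [Field k] {n : ℕ} (dg : Fin n → ℕ) (b c : ℕ) : Set (ℕ → ℕ) := by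
  classical
  exact (fun s d => Module.finrank k (Hom (wtG dg) k 0 d) - s d) ''
    {s : ℕ → ℕ | ∃ r : JJ (wtG dg) b → MonoidAlgebra k (FreeMonoid {i : Fin n // 1 ≤ dg i}),
      (∀ j, r j ∈ Hom (wtG dg) k 0 (wW (wtG dg) j.1)) ∧
      Good (wtG dg) (fun j => wW (wtG dg) j.1) r c ∧
      s = fun d => Module.finrank k (II (wtG dg) (fun j => wW (wtG dg) j.1) r 0 d)}

lemma Ser_finite (k : Type) [Field k] {n : ℕ} (dg : Fin n → ℕ) (b c : ℕ) :
    (Ser k dg b c).Finite := by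
  classical
  apply Set.Finite.image
  exact univ_finite (wtG_pos dg) b c k

lemma alg_mem {𝒜 : ℕ → Submodule k R} (hA : IsConnAlg k R 𝒜) (h1 : (1 : R) ≠ 0) {b c : ℕ}
    {n : ℕ} {g : Fin n → R} {dg : Fin n → ℕ} (hg : ∀ i, g i ∈ 𝒜 (dg i))
    (hspan : Submodule.span Rᵐᵒᵖ (Set.range g) = aug k R 𝒜)
    {m : ℕ} {h : Fin m → (Fin n → R)} {e : Fin m → ℤ} (he : ∀ j, e j ≤ (b : ℤ))
    (hh1 : ∀ j, FreeHomog k R 𝒜 (fun i => (dg i : ℤ)) (h j) (e j))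
    (hh2 : SolSpanBy R R g h) (hh3 : SolGenLE k R (Fin n → R) 𝒜 h e (c : ℤ)) :
    hilbA k R 𝒜 ∈ Ser k dg b (max b c) := by
  classical
  obtain ⟨p, hS⟩ := exists_gr hA
  have hgS : ∀ i, g i ∈ grZ k R 𝒜 (dg i) := fun i => by rw [grZ_nat]; exact hg i
  have hg0 : ∀ i, ¬ 1 ≤ dg i → g i = 0 := by
    intro i hi
    have h2 : g i ∈ aug k R 𝒜 := hspan ▸ Submodule.subset_span ⟨i, rfl⟩
    have h3 := aug_zero hS h2 1
    have h4 : g i ∈ grZ k R 𝒜 0 := by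
      have := hgS i
      rwa [show dg i = 0 by omega] at this
    rwa [mul_one, hS.p_id h4] at h3
  have hsol : ∀ v : Fin n → R, IsSol R R g v ↔ ∑ i, g i * v i = 0 := by
    intro v; simp [IsSol]
  have hdat : Dat (wtG dg) (grZ k R 𝒜) p (fun i => g i.1) :=
    { hS with
      ne := h1
      hwt := wtG_pos dg
      g_mem := fun i => hgS i.1
      gen := by
        intro d hd x hx
        have h2 : x ∈ aug k R 𝒜 := by
          apply Submodule.subset_span
          simp only [Set.mem_iUnion]
          rw [grZ_nat] at hx
          exact ⟨d, hd, hx⟩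
        rw [← hspan] at h2
        obtain ⟨cf, hcf⟩ := span_op h2
        refine ⟨fun i => p (d - dg i.1) (cf i.1), fun i => hS.p_mem _ _, ?_⟩
        rw [← sum_restrict (fun i => 1 ≤ dg i) (fun i => g i * p (d - dg i) (cf i))
          (fun i hi => by rw [hg0 i hi, zero_mul])]
        rw [← hS.p_id hx, hcf, map_sum]
        apply Finset.sum_congr rfl
        intro i _
        rw [op_smul_eq_mul, hS.p_mul (hgS i)] }
  obtain ⟨r, hr1, hr2, hr3⟩ := exists_rel (k := k) (wtG dg) (fun i => g i.1) b
  -- extension by zero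
  let ext : ({i : Fin n // 1 ≤ dg i} → R) → Fin n → R := fun v i =>
    if hi : 1 ≤ dg i then v ⟨i, hi⟩ else 0
  have hext : ∀ v (i : {i : Fin n // 1 ≤ dg i}), ext v i.1 = v i := by
    intro v i; simp [ext, i.2]
  have hext0 : ∀ v i, ¬ 1 ≤ dg i → ext v i = 0 := by
    intro v i hi; simp only [ext, dif_neg hi]
  have hextsol : ∀ v : {i : Fin n // 1 ≤ dg i} → R, ∑ i, g i.1 * v i = 0 →
      IsSol R R g (ext v) := by
    intro v hv
    rw [hsol, sum_restrict (fun i => 1 ≤ dg i) _ (fun i hi => by rw [hg0 i hi, zero_mul])]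
    simpa only [hext] using hv
  have hrel : Rel (wtG dg) (grZ k R 𝒜) p (fun i => g i.1)
      (fun j : JJ (wtG dg) b => wW (wtG dg) j.1) r b (fun l i => h l i.1) e :=
    { hdat with
      hdeg := fun j => j.2.1
      hdegb := fun j => j.2.2
      r_mem := hr1
      r_zero := hr2
      r_gen := hr3
      e_le := he
      h_mem := fun l i => hh1 l i.1
      h_sol := by
        intro l
        have := hh2.1 l
        rw [hsol, sum_restrict (fun i => 1 ≤ dg i) _
          (fun i hi => by rw [hg0 i hi, zero_mul])] at this
        exact this
      h_gen := by
        intro v hv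
        obtain ⟨cf, hcf⟩ := span_op (hh2.2 _ (hextsol v hv))
        refine ⟨cf, fun i => ?_⟩
        rw [← hext v i, hcf]
        simp }
  refine ⟨_, ⟨r, hr1, ?_, rfl⟩, ?_⟩
  · apply hrel.good
    intro d v hv
    have hb : ∀ j : JJ (wtG dg) b, ∃ bb : Fin m → R,
        (∀ l, bb l ∈ grZ k R 𝒜 ((wW (wtG dg) j.1 : ℤ) - e l)) ∧
        ∀ i, ext (hh (fun i => g i.1) r j) i = ∑ l, h l i * bb l := by
      intro j
      obtain ⟨cf, hcf⟩ := span_op (hh2.2 _ (hextsol _ (hrel.hh_sol j)))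
      refine ⟨fun l => p (wW (wtG dg) j.1 - e l) (cf l), fun l => hS.p_mem _ _, fun i => ?_⟩
      have hmem : ext (hh (fun i => g i.1) r j) i ∈
          grZ k R 𝒜 ((wW (wtG dg) j.1 : ℤ) - dg i) := by
        by_cases hi : 1 ≤ dg i
        · have := hrel.hh_mem j ⟨i, hi⟩
          rw [← hext (hh (fun i => g i.1) r j) ⟨i, hi⟩] at this
          exact this
        · rw [hext0 _ _ hi]; exact Submodule.zero_mem _
      rw [← hS.p_id hmem, hcf, Finset.sum_apply, map_sum]
      apply Finset.sum_congr rfl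
      intro l _
      rw [Pi.smul_apply, op_smul_eq_mul, hS.p_mul (hh1 l i)]
      congr 2
      ring_nf
    choose bb hbb hbb' using hb
    have hsolh : ∀ w : Fin m → R, IsSol R (Fin n → R) h w ↔ ∀ i, ∑ l, h l i * w l = 0 := by
      intro w
      rw [IsSol, funext_iff]
      simp [Finset.sum_apply]
    refine hrel.syz_low (N := Fin n) (H := h) (c := c) (le_max_right _ _) (le_max_left _ _)
      Subtype.val (fun l i => rfl) ?_ (fun j => ext (hh (fun i => g i.1) r j))
      (fun j i => hext _ i) ?_ bb hbb hbb' hv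
    · intro w hw
      have := hh3 w ((hsolh w).mpr hw)
      simpa only [hsolh, FreeHomog] using this
    · intro i
      by_cases hi : 1 ≤ dg i
      · exact Or.inr ⟨⟨i, hi⟩, rfl⟩
      · exact Or.inl fun j => hext0 _ _ hi
  · ext1 d
    have := hrel.finrank_eq d
    rw [grZ_nat] at this
    exact this.symm

end Final

end NCGProof

namespace NCG

/-- the set of Hilbert series of algebras in the class `D(n,a,b,c)`
is finite. -/
theorem statement_0 (k : Type) [Field k] (n a b c : ℕ) :
    {h : ℕ → ℕ | ∃ A : AlgData k,
      IsConnAlg k A.carrier A.grading ∧ LocFin k A.carrier A.grading ∧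
      InDClass k A.carrier A.grading n a b c ∧
      h = hilbA k A.carrier A.grading}.Finite := by
  have hfin : (({0} : Set (ℕ → ℕ)) ∪ ⋃ n' ∈ Set.Iic n, ⋃ dg : Fin n' → Fin (a + 1),
      NCGProof.Ser k (fun i => (dg i : ℕ)) b (max b c)).Finite := by
    apply (Set.finite_singleton _).union
    apply Set.Finite.biUnion (Set.finite_Iic n)
    intro n' _
    exact Set.finite_iUnion fun dg => NCGProof.Ser_finite k _ b _
  refine hfin.subset ?_
  rintro _ ⟨A, hA, -, ⟨n', hn', g, dg, hdg, hg, hspan, m, h, e, he, hh1, hh2, hh3⟩, rfl⟩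
  by_cases h1 : (1 : A.carrier) = 0
  · left
    have hsub : Subsingleton A.carrier := subsingleton_of_zero_eq_one h1.symm
    rw [Set.mem_singleton_iff]
    ext1 d
    exact Module.finrank_zero_of_subsingleton
  · right
    simp only [Set.mem_iUnion]
    exact ⟨n', hn', fun i => ⟨dg i, by have := hdg i; omega⟩,
      NCGProof.alg_mem hA h1 hg hspan he hh1 hh2 hh3⟩

end NCG
end

section
/- Let A be a connected locally finite graded k-algebra that is finitely presented, i.e., admits an exact sequence of graded right A-modules F_2 → F_1 → A → k_A → 0 with F_1, F_2 finite graded free. Then for every integer D > 0, the set of Hilbert series of homogeneous right ideals of A generated in degrees ≤ D contains no infinite strictly decreasing sequence with respect to the lexicographic order >_lex on power series. -/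
open MulOpposite

namespace NCG

variable (k : Type) [Field k] (R : Type) [Ring R] [Algebra k R]

variable (M : Type) [AddCommGroup M] [Module Rᵐᵒᵖ M] [Module k M]

theorem eventually_const (H : ℕ → ℕ → ℕ) (hH : ∀ t, LexLtN (H (t + 1)) (H t)) (q : ℕ) :
    ∃ T, ∀ t ≥ T, ∀ i < q, H t i = H T i := by
  induction q with
  | zero => exact ⟨0, by simp⟩
  | succ q ih =>
    obtain ⟨T, hT⟩ := ih
    have hanti : ∀ n, H (T + (n + 1)) q ≤ H (T + n) q := by
      intro n
      obtain ⟨p, hp1, hp2⟩ := hH (T + n)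
      rcases lt_trichotomy p q with h | h | h
      · have h1 := hT (T + n) (by omega) p h
        have h2 := hT (T + n + 1) (by omega) p h
        omega
      · subst h; exact hp2.le
      · exact (hp1 q h).le
    have ha : Antitone (fun n => H (T + n) q) := antitone_nat_of_succ_le hanti
    obtain ⟨n, hn⟩ := WellFoundedLT.antitone_chain_condition (α := ℕ) ha
    refine ⟨T + n, fun t ht i hi => ?_⟩
    rcases Nat.lt_succ_iff_lt_or_eq.1 hi with h | h
    · rw [hT t (by omega) i h, hT (T + n) (by omega) i h]
    · subst h
      have := hn (t - T) (by omega)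
      have h2 : T + (t - T) = t := by omega
      simp only [h2] at this
      exact this.symm

theorem lex_chain (H : ℕ → ℕ → ℕ) (hH : ∀ t, LexLtN (H (t + 1)) (H t)) (t : ℕ) :
    ∃ q, ∀ s, ∃ r ≤ q, (∀ i < r, H (t + (s + 1)) i = H t i) ∧ H (t + (s + 1)) r < H t r := by
  obtain ⟨q, hq1, hq2⟩ := hH t
  refine ⟨q, fun s => ?_⟩
  induction s with
  | zero => exact ⟨q, le_rfl, hq1, hq2⟩
  | succ s ih =>
    obtain ⟨r, hr, h1, h2⟩ := ih
    obtain ⟨p, hp1, hp2⟩ := hH (t + (s + 1))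
    rcases lt_trichotomy p r with h | h | h
    · refine ⟨p, by omega, fun i hi => ?_, ?_⟩
      · exact (hp1 i hi).trans (h1 i (by omega))
      · rw [← h1 p h]; exact hp2
    · subst h
      exact ⟨p, hr, fun i hi => (hp1 i hi).trans (h1 i hi), lt_trans hp2 h2⟩
    · refine ⟨r, hr, fun i hi => (hp1 i (by omega)).trans (h1 i hi), ?_⟩
      exact lt_of_le_of_lt (hp1 r h).le h2

theorem noeth_minors (k E : Type) [Field k] [AddCommGroup E] [Module k E]
    [FiniteDimensional k E] {α : Type} (s : α → ℕ)
    (M : ∀ a, Matrix (Fin (s a)) (Fin (s a)) (E →ₗ[k] k)) :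
    ∃ F : Finset α, ∀ e : E, (∀ a ∈ F, ((M a).map (fun l => l e)).det = 0) →
      ∀ a, ((M a).map (fun l => l e)).det = 0 := by
  classical
  let b := Module.finBasis k E
  let L : (E →ₗ[k] k) → MvPolynomial (Fin (Module.finrank k E)) k :=
    fun l => ∑ i, MvPolynomial.C (l (b i)) * MvPolynomial.X i
  have hL : ∀ (e : E) l, MvPolynomial.eval (fun i => b.repr e i) (L l) = l e := by
    intro e l
    simp only [L, map_sum, map_mul, MvPolynomial.eval_C, MvPolynomial.eval_X]
    conv_rhs => rw [← b.sum_repr e, map_sum]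
    refine Finset.sum_congr rfl fun i _ => ?_
    rw [map_smul, smul_eq_mul, mul_comm]
  let P : α → MvPolynomial (Fin (Module.finrank k E)) k := fun a => ((M a).map L).det
  have hP : ∀ (e : E) a, MvPolynomial.eval (fun i => b.repr e i) (P a)
      = ((M a).map (fun l => l e)).det := by
    intro e a
    simp only [P]
    rw [RingHom.map_det]
    congr 1
    ext i j
    simp [hL]
  have hfg : (Ideal.span (Set.range P)).FG := IsNoetherian.noetherian _
  obtain ⟨u, hu, hu2⟩ := (Submodule.fg_span_iff_fg_span_finset_subset _).1 hfg
  rw [← Set.image_univ] at hu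
  obtain ⟨F, -, hF⟩ := Finset.subset_set_image_iff.1 hu
  refine ⟨F, fun e he a => ?_⟩
  rw [← hP]
  have hle : Ideal.span (Set.range P) ≤
      RingHom.ker (MvPolynomial.eval (fun i => b.repr e i)) := by
    have : Ideal.span (Set.range P) = Ideal.span (u : Set _) := hu2
    rw [this, Ideal.span_le]
    intro x hx
    rw [← hF] at hx
    simp only [Finset.coe_image] at hx
    obtain ⟨a, ha, rfl⟩ := hx
    simp only [SetLike.mem_coe, RingHom.mem_ker]
    rw [hP]
    exact he a ha
  exact hle (Ideal.subset_span ⟨a, rfl⟩)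

theorem exists_minor (k W : Type) [Field k] [AddCommGroup W] [Module k W] {τ : Type}
    (g : τ → W) [FiniteDimensional k (Submodule.span k (Set.range g))] (s : ℕ)
    (hs : s ≤ Module.finrank k (Submodule.span k (Set.range g))) :
    ∃ (φ : Fin s → W →ₗ[k] k) (c : Fin s → τ),
      (Matrix.of (fun i j => φ i (g (c j)))).det ≠ 0 := by
  classical
  obtain ⟨u, hu, hu2, hu3⟩ := exists_linearIndependent k (Set.range g)
  have : FiniteDimensional k (Submodule.span k u) := by rw [hu2]; infer_instance
  have hfin : Finite u := by
    have h0 : LinearIndependent k (fun x : u =>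
        (⟨x, Submodule.subset_span x.2⟩ : Submodule.span k u)) := by
      apply LinearIndependent.of_comp (Submodule.span k u).subtype
      exact hu3
    exact h0.finite
  have := Fintype.ofFinite u
  have hcard : Fintype.card u = Module.finrank k (Submodule.span k (Set.range g)) := by
    rw [← hu2]
    have := finrank_span_eq_card hu3
    rw [Subtype.range_coe] at this
    exact this.symm
  have hs' : s ≤ Fintype.card u := by omega
  obtain ⟨ι⟩ : Nonempty (Fin s ↪ u) := by
    apply Function.Embedding.nonempty_of_card_le
    simpa using hs'
  choose c hc using fun j => hu (ι j).2
  have hv : LinearIndependent k (fun j => g (c j)) := by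
    have := hu3.comp ι ι.injective
    convert this using 1
    funext j
    exact hc j
  let B := Module.Basis.span hv
  obtain ⟨π, hπ⟩ := LinearMap.exists_leftInverse_of_injective
    (Submodule.span k (Set.range fun j => g (c j))).subtype (by simp)
  refine ⟨fun i => (B.coord i).comp π, c, ?_⟩
  have : (Matrix.of (fun i j => ((B.coord i).comp π) (g (c j)))) = 1 := by
    ext i j
    have h1 : π (g (c j)) = B j := by
      have h2 := LinearMap.congr_fun hπ (B j)
      simp only [LinearMap.comp_apply, Submodule.subtype_apply, LinearMap.id_apply] at h2
      rw [← h2]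
      congr 1
      exact congrArg Subtype.val (Module.Basis.span_apply hv j).symm
    simp [h1, Matrix.one_apply, Finsupp.single_apply, eq_comm]
  rw [this]
  simp

theorem minor_le (k W : Type) [Field k] [AddCommGroup W] [Module k W] {τ : Type}
    (g : τ → W) [FiniteDimensional k (Submodule.span k (Set.range g))] (s : ℕ)
    (φ : Fin s → W →ₗ[k] k) (c : Fin s → τ)
    (h : (Matrix.of (fun i j => φ i (g (c j)))).det ≠ 0) :
    s ≤ Module.finrank k (Submodule.span k (Set.range g)) := by
  have hcol := Matrix.linearIndependent_cols_of_det_ne_zero h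
  have hv : LinearIndependent k (fun j =>
      (⟨g (c j), Submodule.subset_span ⟨c j, rfl⟩⟩ : Submodule.span k (Set.range g))) := by
    apply LinearIndependent.of_comp
      ((LinearMap.pi φ).comp (Submodule.span k (Set.range g)).subtype)
    exact hcol
  simpa using hv.fintype_card_le_finrank

theorem exists_range_eq (k V : Type) [Field k] [AddCommGroup V] [Module k V]
    (p : Submodule k V) : ∃ f : V →ₗ[k] V, LinearMap.range f = p := by
  obtain ⟨π, hπ⟩ := LinearMap.exists_leftInverse_of_injective p.subtype (by simp)
  refine ⟨p.subtype.comp π, ?_⟩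
  rw [LinearMap.range_comp, LinearMap.range_eq_top.2, Submodule.map_top, Submodule.range_subtype]
  intro x
  exact ⟨x, LinearMap.congr_fun hπ x⟩

/-- index set for the degree `q` products of generators and coefficients. -/
def Tq (𝒜 : ℕ → Submodule k R) (D q : ℕ) : Type :=
  Σ d : Fin (D + 1), {c : R // (d : ℕ) ≤ q ∧ c ∈ 𝒜 (q - d)} × 𝒜 d

/-- the product of a parametrized generator and a coefficient. -/
def wq (𝒜 : ℕ → Submodule k R) (D q : ℕ) (τ : Tq k R 𝒜 D q) :
    (∀ d : Fin (D + 1), 𝒜 d →ₗ[k] 𝒜 d) →ₗ[k] R :=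
  (LinearMap.mulRight k τ.2.1.1) ∘ₗ (𝒜 τ.1).subtype ∘ₗ
    (LinearMap.applyₗ τ.2.2) ∘ₗ LinearMap.proj τ.1

theorem wq_apply (𝒜 : ℕ → Submodule k R) (D q : ℕ) (τ : Tq k R 𝒜 D q)
    (f : ∀ d : Fin (D + 1), 𝒜 d →ₗ[k] 𝒜 d) :
    wq k R 𝒜 D q τ f = (f τ.1 τ.2.2 : R) * τ.2.1.1 := rfl

theorem span_wq (𝒜 : ℕ → Submodule k R) (hconn : IsConnAlg k R 𝒜) (D : ℕ)
    (I : Submodule Rᵐᵒᵖ R) (hI : GenLE k R R (grZ k R 𝒜) I (D : ℤ))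
    (f : ∀ d : Fin (D + 1), 𝒜 d →ₗ[k] 𝒜 d)
    (hf : ∀ d : Fin (D + 1), LinearMap.range (f d)
      = (I.restrictScalars k).comap (𝒜 d).subtype) (q : ℕ) :
    Submodule.span k (Set.range fun τ => wq k R 𝒜 D q τ f) = 𝒜 q ⊓ I.restrictScalars k := by
  classical
  obtain ⟨hmul, hint, h0⟩ := hconn
  letI : SetLike.GradedMonoid 𝒜 :=
    { one_mem := by rw [h0]; exact Submodule.mem_span_singleton_self _
      mul_mem := fun i j x y hx hy => hmul i j x hx y hy }
  letI : DirectSum.Decomposition 𝒜 := hint.chooseDecomposition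
  letI : GradedRing 𝒜 := { }
  apply le_antisymm
  · rw [Submodule.span_le]
    rintro _ ⟨⟨d, ⟨c, hdq, hc⟩, a⟩, rfl⟩
    change (f d a : R) * c ∈ _
    refine ⟨?_, ?_⟩
    · have := hmul _ _ _ (f d a).2 _ hc
      rwa [Nat.add_sub_cancel' hdq] at this
    · have h1 : f d a ∈ LinearMap.range (f d) := ⟨a, rfl⟩
      rw [hf] at h1
      have h2 : (f d a : R) ∈ I := h1
      exact I.smul_mem (op c) h2
  · rintro x ⟨hx, hxI⟩
    have key : ∀ y ∈ Submodule.span Rᵐᵒᵖ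
        {x : R | x ∈ I ∧ ∃ j ≤ (D : ℤ), x ∈ grZ k R 𝒜 j}, ∀ r : R,
        ((DirectSum.decompose 𝒜 (y * r)) q : R) ∈
          Submodule.span k (Set.range fun τ => wq k R 𝒜 D q τ f) := by
      intro y hy
      induction hy using Submodule.span_induction with
      | mem y hy =>
        intro r
        obtain ⟨hyI, j, hj, hyj⟩ := hy
        unfold grZ at hyj
        split_ifs at hyj with hj0
        · rw [DirectSum.coe_decompose_mul_of_left_mem 𝒜 q hyj]
          split_ifs with hle
          · have hlt : j.toNat < D + 1 := by omega
            have h1 : (⟨y, hyj⟩ : 𝒜 j.toNat) ∈ LinearMap.range (f ⟨j.toNat, hlt⟩) := by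
              rw [hf]; exact hyI
            obtain ⟨a, ha⟩ := h1
            apply Submodule.subset_span
            refine ⟨⟨⟨j.toNat, hlt⟩, ⟨_, hle, (DirectSum.decompose 𝒜 r (q - j.toNat)).2⟩, a⟩, ?_⟩
            exact congrArg (fun z : 𝒜 j.toNat =>
              (z : R) * (DirectSum.decompose 𝒜 r (q - j.toNat) : R)) ha
          · exact Submodule.zero_mem _
        · rw [Submodule.mem_bot] at hyj
          simp [hyj]
      | zero => intro r; simp
      | add y z _ _ h1 h2 =>
        intro r
        rw [add_mul, DirectSum.decompose_add]
        exact Submodule.add_mem _ (h1 r) (h2 r)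
      | smul s y _ h1 =>
        intro r
        have : (s • y) * r = y * (unop s * r) := by
          rw [← op_unop s, op_smul_eq_mul, mul_assoc]; rfl
        rw [this]
        exact h1 _
    have := key x (hI hxI) 1
    rwa [mul_one, DirectSum.decompose_of_mem_same 𝒜 hx] at this

/-- over a finitely presented connected algebra, the set of Hilbert
series of right ideals generated in degrees at most `D` has no infinite strictly
decreasing sequence in the lexicographic order. -/
theorem statement_1 (k R : Type) [Field k] [Ring R] [Algebra k R]
    (𝒜 : ℕ → Submodule k R) (hconn : IsConnAlg k R 𝒜) (hlf : LocFin k R 𝒜)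
    (hfp : AlgFinPres k R 𝒜) (D : ℕ) (hD : 0 < D) :
    ¬ ∃ I : ℕ → Submodule Rᵐᵒᵖ R,
      (∀ t, GenLE k R R (grZ k R 𝒜) (I t) (D : ℤ)) ∧
      (∀ t, LexLtN (hilbI k R 𝒜 (I (t + 1))) (hilbI k R 𝒜 (I t))) := by
  rintro ⟨I, hI, hlex⟩
  have hlf' : ∀ i, FiniteDimensional k (𝒜 i) := hlf
  set H : ℕ → ℕ → ℕ := fun t => hilbI k R 𝒜 (I t) with hH
  choose T hT using eventually_const H hlex
  let h : ℕ → ℕ := fun q => H (T (q + 1)) q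
  have hh : ∀ q, ∀ t ≥ T (q + 1), H t q = h q := fun q t ht => hT (q + 1) t ht q (by omega)
  choose e he using fun t (d : Fin (D + 1)) =>
    exists_range_eq k (𝒜 d) (((I t).restrictScalars k).comap (𝒜 d).subtype)
  have hspan := fun t q => span_wq k R 𝒜 hconn D (I t) (hI t) (e t) (he t) q
  have hfd : ∀ t q, FiniteDimensional k
      (Submodule.span k (Set.range fun τ => wq k R 𝒜 D q τ (e t))) := by
    intro t q
    rw [hspan]
    exact Submodule.finiteDimensional_of_le inf_le_left
  have hrank : ∀ t q, Module.finrank k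
      (Submodule.span k (Set.range fun τ => wq k R 𝒜 D q τ (e t))) = H t q := by
    intro t q
    rw [hspan]
    rfl
  obtain ⟨F, hF⟩ := noeth_minors k (∀ d : Fin (D + 1), 𝒜 d →ₗ[k] 𝒜 d)
    (α := Σ q : ℕ, (Fin (h q + 1) → (R →ₗ[k] k)) × (Fin (h q + 1) → Tq k R 𝒜 D q))
    (fun a => h a.1 + 1)
    (fun a => Matrix.of fun i j => (a.2.1 i) ∘ₗ (wq k R 𝒜 D a.1 (a.2.2 j)))
  let t := F.sup (fun a => T (a.1 + 1))
  have hle : ∀ q, H t q ≤ h q := by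
    intro q
    by_contra hcon
    push Not at hcon
    obtain ⟨φ, c, hdet⟩ := exists_minor k R (fun τ => wq k R 𝒜 D q τ (e t)) (h q + 1)
      (by rw [hrank]; omega)
    apply hdet
    refine hF (e t) ?_ ⟨q, φ, c⟩
    rintro ⟨q', φ', c'⟩ ha
    by_contra hne
    have h1 := minor_le k R (fun τ => wq k R 𝒜 D q' τ (e t)) (h q' + 1) φ' c' hne
    rw [hrank, hh q' t (Finset.le_sup (f := fun a => T (a.1 + 1)) ha)] at h1
    omega
  obtain ⟨q, hq⟩ := lex_chain H hlex t
  obtain ⟨r, hr, -, hlt⟩ := hq ((Finset.range (q + 1)).sup (fun i => T (i + 1)))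
  have hbig : T (r + 1) ≤ (Finset.range (q + 1)).sup (fun i => T (i + 1)) :=
    Finset.le_sup (f := fun i => T (i + 1)) (Finset.mem_range.2 (by omega))
  rw [hh r _ (by omega)] at hlt
  have := hle r
  omega

end NCG
end

section
/- Let A be a connected locally finite graded k-algebra admitting an exact sequence of graded right A-modules F_3 → F_2 → F_1 → A → k_A → 0 with all F_i finite graded free (i.e., A is finitely presented and dim_k Tor_3^A(k,k) < ∞). Then for every integer D > 0, the set of Hilbert series of homogeneous right ideals I of A that admit an exact sequence G_1 → G_0 → I → 0 of graded modules with G_0, G_1 finite graded free having homogeneous bases in degrees ≤ D (i.e., ideals with generators and relations in degrees at most D) is finite. -/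
open MulOpposite

namespace NCG

variable (k : Type) [Field k] (R : Type) [Ring R] [Algebra k R]

variable (M : Type) [AddCommGroup M] [Module Rᵐᵒᵖ M] [Module k M]

theorem exists_rank_factor {k : Type*} [Field k] {a b : Type} [Fintype a] [Fintype b]
    [DecidableEq a] [DecidableEq b] (A : Matrix a b k) (r : ℕ) (hr : A.rank = r) :
    ∃ (P : Matrix (Fin r) a k) (Q : Matrix b (Fin r) k), P * A * Q = 1 := by
  let T := Matrix.toLin' A
  have hr : Module.finrank k (LinearMap.range T) = r := hr
  let e : (Fin r → k) ≃ₗ[k] LinearMap.range T :=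
    LinearEquiv.ofFinrankEq _ _ (by simp [hr])
  obtain ⟨s, hs⟩ :=
    T.rangeRestrict.exists_rightInverse_of_surjective (LinearMap.range_rangeRestrict T)
  obtain ⟨l, hl⟩ :=
    (LinearMap.range T).subtype.exists_leftInverse_of_injective (Submodule.ker_subtype _)
  refine ⟨LinearMap.toMatrix' (e.symm.toLinearMap ∘ₗ l),
    LinearMap.toMatrix' (s ∘ₗ e.toLinearMap), ?_⟩
  have hA : A = LinearMap.toMatrix' T := (LinearMap.toMatrix'_toLin' A).symm
  rw [hA, ← LinearMap.toMatrix'_comp, ← LinearMap.toMatrix'_comp, ← LinearMap.toMatrix'_id]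
  congr 1
  refine LinearMap.ext fun x => ?_
  have h1 := LinearMap.congr_fun hs (e x)
  have h2 : T (s (e x)) = (e x : a → k) := congrArg Subtype.val h1
  have h3 := LinearMap.congr_fun hl (e x)
  simp only [LinearMap.comp_apply, Submodule.subtype_apply, LinearMap.id_apply] at h3
  simp [h2, h3]

theorem rank_ge_of_map {S k K : Type*} [CommRing S] [Field k] [Field K] [Algebra k S]
    (p : S →ₐ[k] k) (f : S →+* K) (hf : RingHom.ker f ≤ RingHom.ker p)
    {a b : Type} [Fintype a] [Fintype b] [DecidableEq a] [DecidableEq b] (Φ : Matrix a b S) :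
    (Φ.map p).rank ≤ (Φ.map f).rank := by
  obtain ⟨r, hr⟩ : ∃ r, (Φ.map p).rank = r := ⟨_, rfl⟩
  obtain ⟨P, Q, h⟩ := exists_rank_factor _ r hr
  rw [hr]
  let c := algebraMap k S
  let Z : Matrix (Fin r) (Fin r) S := P.map c * Φ * Q.map c
  have hZ : Z.map p = 1 := by
    have hc : ∀ x, p (c x) = x := fun x => by simp [c]
    rw [← h]
    simp only [Z]
    change (P.map c * Φ * Q.map c).map p.toRingHom = P * Φ.map p.toRingHom * Q
    rw [Matrix.map_mul, Matrix.map_mul, Matrix.map_map, Matrix.map_map]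
    have hc2 : (p.toRingHom ∘ c : k → k) = id := funext hc
    simp only [hc2, Matrix.map_id]
  have hdet : p Z.det = 1 := by
    have := RingHom.map_det p.toRingHom Z
    simp only [AlgHom.toRingHom_eq_coe, RingHom.mapMatrix_apply, RingHom.coe_coe] at this
    rw [this]
    simp [hZ]
  have hdet2 : f Z.det ≠ 0 := fun h0 => by
    have : Z.det ∈ RingHom.ker p := hf h0
    rw [RingHom.mem_ker] at this
    rw [this] at hdet
    exact zero_ne_one hdet
  have hdet3 : (Z.map f).det ≠ 0 := by
    rwa [RingHom.map_det, RingHom.mapMatrix_apply] at hdet2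
  have hu : IsUnit (Z.map f) := by
    rw [Matrix.isUnit_iff_isUnit_det]; exact hdet3.isUnit
  have hrk := Matrix.rank_of_isUnit _ hu
  rw [Fintype.card_fin] at hrk
  rw [← hrk]
  simp only [Z]
  rw [Matrix.map_mul, Matrix.map_mul]
  exact (Matrix.rank_mul_le_left _ _).trans (Matrix.rank_mul_le_right _ _)

theorem rank_sum_le {K : Type*} [Field K] {a b c : Type} [Fintype a] [Fintype b] [Fintype c]
    (A : Matrix a b K) (B : Matrix b c K) (h : A * B = 0) : A.rank + B.rank ≤ Fintype.card b := by
  have h1 := A.mulVecLin.finrank_range_add_finrank_ker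
  have h2 : LinearMap.range B.mulVecLin ≤ LinearMap.ker A.mulVecLin := by
    rintro _ ⟨x, rfl⟩
    simp [Matrix.mulVec_mulVec, h]
  have h3 := Submodule.finrank_mono h2
  rw [Module.finrank_fintype_fun_eq_card] at h1
  unfold Matrix.rank
  omega

theorem mat_finite {k σ : Type} [Field k] [Finite σ] (a b c : ℕ → ℕ)
    (Φ : ∀ n, Matrix (Fin (a n)) (Fin (b n)) (MvPolynomial σ k))
    (Ψ : ∀ n, Matrix (Fin (b n)) (Fin (c n)) (MvPolynomial σ k))
    (E : Set (σ → k))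
    (h0 : ∀ w ∈ E, ∀ n, (Φ n).map (MvPolynomial.aeval w) * (Ψ n).map (MvPolynomial.aeval w) = 0)
    (h1 : ∀ w ∈ E, ∀ n, b n ≤ ((Φ n).map (MvPolynomial.aeval w)).rank +
      ((Ψ n).map (MvPolynomial.aeval w)).rank) :
    {hh : ℕ → ℕ | ∃ w ∈ E, hh = fun n => ((Φ n).map (MvPolynomial.aeval w)).rank}.Finite := by
  let S := MvPolynomial σ k
  let ev : (σ → k) → (S →ₐ[k] k) := fun w => MvPolynomial.aeval w
  let J0 : Ideal S := ⨅ w ∈ E, RingHom.ker (ev w)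
  have hfin := Ideal.finite_minimalPrimes_of_isNoetherianRing S J0
  refine (hfin.image (fun J => fun n =>
    ((Φ n).map (algebraMap S (FractionRing (S ⧸ J)))).rank)).subset ?_
  rintro hh ⟨w, hw, rfl⟩
  have hle : J0 ≤ RingHom.ker (ev w) := iInf₂_le w hw
  have : (RingHom.ker (ev w)).IsPrime := RingHom.ker_isPrime _
  obtain ⟨J, hJ, hJw⟩ := Ideal.exists_minimalPrimes_le hle
  refine ⟨J, hJ, ?_⟩
  have : J.IsPrime := hJ.1.1
  have hJ0 : J0 ≤ J := hJ.1.2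
  funext n
  let K := FractionRing (S ⧸ J)
  let f : S →+* K := algebraMap S K
  have hfx : ∀ x, f x = 0 ↔ x ∈ J := by
    intro x
    have : f x = algebraMap (S ⧸ J) K (Ideal.Quotient.mk J x) := rfl
    rw [this, map_eq_zero_iff _ (IsFractionRing.injective (S ⧸ J) K), Ideal.Quotient.eq_zero_iff_mem]
  have hker : RingHom.ker f ≤ RingHom.ker (ev w) := fun x hx => hJw ((hfx x).1 hx)
  have r1 := rank_ge_of_map (ev w) f hker (Φ n)
  have r2 := rank_ge_of_map (ev w) f hker (Ψ n)
  have hz : (Φ n).map f * (Ψ n).map f = 0 := by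
    rw [← Matrix.map_mul]
    ext i j
    simp only [Matrix.map_apply, Matrix.zero_apply]
    rw [hfx]
    apply hJ0
    simp only [J0, Submodule.mem_iInf]
    intro w' hw'
    have := congrFun (congrFun (h0 w' hw' n) i) j
    have h2 : ((Φ n).map (ev w').toRingHom * (Ψ n).map (ev w').toRingHom) i j = 0 := this
    rw [← Matrix.map_mul] at h2
    exact h2
  have r3 := rank_sum_le _ _ hz
  have r4 := h1 w hw n
  simp only [Fintype.card_fin] at r3
  change ((Φ n).map f).rank = ((Φ n).map (ev w)).rank
  change b n ≤ ((Φ n).map (ev w)).rank + ((Ψ n).map (ev w)).rank at r4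
  omega

theorem lin_finite {k W : Type} [Field k] [AddCommGroup W] [Module k W] [FiniteDimensional k W]
    (A G H : ℕ → Type) [∀ n, AddCommGroup (A n)] [∀ n, AddCommGroup (G n)] [∀ n, AddCommGroup (H n)]
    [∀ n, Module k (A n)] [∀ n, Module k (G n)] [∀ n, Module k (H n)]
    [∀ n, FiniteDimensional k (A n)] [∀ n, FiniteDimensional k (G n)]
    [∀ n, FiniteDimensional k (H n)]
    (Φ : ∀ n, W →ₗ[k] (G n →ₗ[k] A n)) (Ψ : ∀ n, W →ₗ[k] (H n →ₗ[k] G n)) :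
    {hh : ℕ → ℕ | ∃ w : W, (∀ n, LinearMap.range (Ψ n w) = LinearMap.ker (Φ n w)) ∧
      hh = fun n => Module.finrank k (LinearMap.range (Φ n w))}.Finite := by
  let bW := Module.finBasis k W
  let bA := fun n => Module.finBasis k (A n)
  let bG := fun n => Module.finBasis k (G n)
  let bH := fun n => Module.finBasis k (H n)
  let MΦ := fun n => Matrix.of fun i j =>
    ∑ s, MvPolynomial.C (LinearMap.toMatrix (bG n) (bA n) (Φ n (bW s)) i j) * MvPolynomial.X s
  let MΨ := fun n => Matrix.of fun i j =>
    ∑ s, MvPolynomial.C (LinearMap.toMatrix (bH n) (bG n) (Ψ n (bW s)) i j) * MvPolynomial.X s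
  have eΦ : ∀ w n, (MΦ n).map (MvPolynomial.aeval (bW.repr w)) =
      LinearMap.toMatrix (bG n) (bA n) (Φ n w) := by
    intro w n
    have := congrArg (fun z => LinearMap.toMatrix (bG n) (bA n) (Φ n z)) (bW.sum_repr w)
    beta_reduce at this
    rw [← this]
    simp only [map_sum, map_smul]
    ext i j
    simp only [MΦ, Matrix.map_apply, Matrix.of_apply, map_sum, map_mul, MvPolynomial.aeval_C,
      MvPolynomial.aeval_X, Matrix.sum_apply, Matrix.smul_apply, smul_eq_mul, mul_comm]
    rfl
  have eΨ : ∀ w n, (MΨ n).map (MvPolynomial.aeval (bW.repr w)) =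
      LinearMap.toMatrix (bH n) (bG n) (Ψ n w) := by
    intro w n
    have := congrArg (fun z => LinearMap.toMatrix (bH n) (bG n) (Ψ n z)) (bW.sum_repr w)
    beta_reduce at this
    rw [← this]
    simp only [map_sum, map_smul]
    ext i j
    simp only [MΨ, Matrix.map_apply, Matrix.of_apply, map_sum, map_mul, MvPolynomial.aeval_C,
      MvPolynomial.aeval_X, Matrix.sum_apply, Matrix.smul_apply, smul_eq_mul, mul_comm]
    rfl
  have rΦ : ∀ w n, (LinearMap.toMatrix (bG n) (bA n) (Φ n w)).rank =
      Module.finrank k (LinearMap.range (Φ n w)) := by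
    intro w n
    rw [Matrix.rank_eq_finrank_range_toLin _ (bA n) (bG n), Matrix.toLin_toMatrix]
  have rΨ : ∀ w n, (LinearMap.toMatrix (bH n) (bG n) (Ψ n w)).rank =
      Module.finrank k (LinearMap.range (Ψ n w)) := by
    intro w n
    rw [Matrix.rank_eq_finrank_range_toLin _ (bG n) (bH n), Matrix.toLin_toMatrix]
  refine (mat_finite _ _ _ MΦ MΨ {v | ∃ w : W, v = bW.repr w ∧
    ∀ n, LinearMap.range (Ψ n w) = LinearMap.ker (Φ n w)} ?_ ?_).subset ?_
  · rintro _ ⟨w, rfl, hw⟩ n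
    rw [eΦ, eΨ, ← LinearMap.toMatrix_comp, LinearMap.range_le_ker_iff.1 (hw n).le]
    simp
  · rintro _ ⟨w, rfl, hw⟩ n
    rw [eΦ, eΨ, rΦ, rΨ, hw n, LinearMap.finrank_range_add_finrank_ker]
  · rintro _ ⟨w, hw, rfl⟩
    refine ⟨_, ⟨w, rfl, hw⟩, ?_⟩
    funext n
    rw [eΦ, rΦ]

theorem exists_span_fam {k V : Type} [Field k] [AddCommGroup V] [Module k V]
    [FiniteDimensional k V] (U : Submodule k V) :
    ∃ y : Fin (Module.finrank k V) → V, Submodule.span k (Set.range y) = U := by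
  obtain ⟨p, hp⟩ := U.subtype.exists_leftInverse_of_injective (Submodule.ker_subtype _)
  have hps : Function.Surjective p := fun u => ⟨u, LinearMap.congr_fun hp u⟩
  let b := Module.finBasis k V
  refine ⟨fun i => (U.subtype ∘ₗ p) (b i), ?_⟩
  have : Set.range (fun i => (U.subtype ∘ₗ p) (b i)) = (U.subtype ∘ₗ p) '' Set.range b := by
    rw [← Set.range_comp]; rfl
  rw [this, Submodule.span_image, b.span_eq, Submodule.map_top, LinearMap.range_comp,
    LinearMap.range_eq_top.2 hps, Submodule.map_top, Submodule.range_subtype]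

section graded

variable {k : Type} [Field k] {R : Type} [Ring R] [Algebra k R] {𝒜 : ℕ → Submodule k R}

theorem grZ_nat (n : ℕ) : grZ k R 𝒜 (n : ℤ) = 𝒜 n := by simp [grZ]

theorem grZ_neg {j : ℤ} (h : j < 0) : grZ k R 𝒜 j = ⊥ := by
  simp [grZ, not_le.2 h]

theorem grZ_mul (hconn : IsConnAlg k R 𝒜) {i j n : ℤ} (h : i + j = n) {x y : R}
    (hx : x ∈ grZ k R 𝒜 i) (hy : y ∈ grZ k R 𝒜 j) : x * y ∈ grZ k R 𝒜 n := by
  subst h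
  rcases lt_or_ge i 0 with hi | hi
  · rw [grZ_neg hi, Submodule.mem_bot] at hx
    simp [hx]
  rcases lt_or_ge j 0 with hj | hj
  · rw [grZ_neg hj, Submodule.mem_bot] at hy
    simp [hy]
  lift i to ℕ using hi
  lift j to ℕ using hj
  rw [grZ_nat] at hx hy
  rw [← Nat.cast_add, grZ_nat]
  exact hconn.1 i j x hx y hy

theorem grZ_fin (hlf : LocFin k R 𝒜) (j : ℤ) : FiniteDimensional k (grZ k R 𝒜 j) := by
  rcases lt_or_ge j 0 with hj | hj
  · rw [grZ_neg hj]; infer_instance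
  · lift j to ℕ using hj
    rw [grZ_nat]; exact hlf j

theorem grZ_smul_one (hconn : IsConnAlg k R 𝒜) (c : k) : c • (1 : R) ∈ grZ k R 𝒜 0 := by
  have := grZ_nat (𝒜 := 𝒜) 0
  rw [Nat.cast_zero] at this
  rw [this, hconn.2.2]
  exact Submodule.smul_mem _ _ (Submodule.mem_span_singleton_self _)

theorem exists_proj (hconn : IsConnAlg k R 𝒜) : ∃ π : ℤ → R →+ R,
    (∀ j x, π j x ∈ grZ k R 𝒜 j) ∧ (∀ j, ∀ x ∈ grZ k R 𝒜 j, π j x = x) ∧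
    ∀ i j, ∀ x ∈ grZ k R 𝒜 i, ∀ y, π (i + j) (x * y) = x * π j y := by
  classical
  have hgm : SetLike.GradedMonoid 𝒜 :=
    { one_mem := by rw [hconn.2.2]; exact Submodule.mem_span_singleton_self _
      mul_mem := fun i j x y hx hy => hconn.1 i j x hx y hy }
  let _ : DirectSum.Decomposition 𝒜 := hconn.2.1.chooseDecomposition
  let _ : GradedRing 𝒜 := { hgm, (inferInstance : DirectSum.Decomposition 𝒜) with }
  refine ⟨fun j => if 0 ≤ j then GradedRing.proj 𝒜 j.toNat else 0, ?_, ?_, ?_⟩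
  · intro j x
    dsimp only
    split_ifs with h
    · lift j to ℕ using h
      rw [grZ_nat]
      simp [GradedRing.proj_apply]
    · simp
  · intro j x hx
    dsimp only
    split_ifs with h
    · lift j to ℕ using h
      rw [grZ_nat] at hx
      simp only [Int.toNat_natCast, GradedRing.proj_apply]
      exact DirectSum.decompose_of_mem_same _ hx
    · rw [grZ_neg (not_le.1 h), Submodule.mem_bot] at hx
      simp [hx]
  · intro i j x hx y
    rcases lt_or_ge i 0 with hi | hi
    · rw [grZ_neg hi, Submodule.mem_bot] at hx
      simp [hx]
    lift i to ℕ using hi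
    rw [grZ_nat] at hx
    rcases lt_or_ge j 0 with hj | hj
    · simp only [not_le.2 hj, if_false, AddMonoidHom.zero_apply, mul_zero]
      split_ifs with h
      · rw [GradedRing.proj_apply]
        exact DirectSum.coe_decompose_mul_of_left_mem_of_not_le 𝒜 hx (by omega)
      · simp
    · lift j to ℕ using hj
      have h1 : (0 : ℤ) ≤ i + j := by positivity
      have h2 : ((i : ℤ) + j).toNat = i + j := by omega
      simp only [h1, if_true, h2, Int.natCast_nonneg, Int.toNat_natCast, GradedRing.proj_apply]
      rw [DirectSum.coe_decompose_mul_of_left_mem_of_le 𝒜 hx (by omega), Nat.add_sub_cancel_left]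

theorem homog_comb_mod (hconn : IsConnAlg k R 𝒜) {L Q : Type} [Fintype Q]
    (h : Q → L → R) (d : L → ℤ) (e : Q → ℤ)
    (hh : ∀ q l, h q l ∈ grZ k R 𝒜 (e q - d l)) (n : ℤ) (v : L → R)
    (hv : ∀ l, v l ∈ grZ k R 𝒜 (n - d l)) (hs : v ∈ Submodule.span Rᵐᵒᵖ (Set.range h)) :
    ∃ a : Q → R, (∀ q, a q ∈ grZ k R 𝒜 (n - e q)) ∧ ∀ l, ∑ q, h q l * a q = v l := by
  obtain ⟨π, h1, h2, h3⟩ := exists_proj hconn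
  obtain ⟨c, hc⟩ := (Submodule.mem_span_range_iff_exists_fun _).1 hs
  refine ⟨fun q => π (n - e q) (unop (c q)), fun q => h1 _ _, fun l => ?_⟩
  have hl : ∑ q, h q l * unop (c q) = v l := by
    rw [← hc]
    simp [MulOpposite.smul_eq_mul_unop]
  have := congrArg (π (n - d l)) hl
  rw [h2 _ _ (hv l), map_sum] at this
  rw [← this]
  refine Finset.sum_congr rfl fun q _ => ?_
  rw [← h3 _ _ _ (hh q l)]
  congr 2
  ring

theorem homog_comb (hconn : IsConnAlg k R 𝒜) {Q : Type} [Fintype Q]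
    (h : Q → R) (e : Q → ℤ)
    (hh : ∀ q, h q ∈ grZ k R 𝒜 (e q)) (n : ℤ) (v : R)
    (hv : v ∈ grZ k R 𝒜 n) (hs : v ∈ Submodule.span Rᵐᵒᵖ (Set.range h)) :
    ∃ a : Q → R, (∀ q, a q ∈ grZ k R 𝒜 (n - e q)) ∧ ∑ q, h q * a q = v := by
  obtain ⟨π, h1, h2, h3⟩ := exists_proj hconn
  obtain ⟨c, hc⟩ := (Submodule.mem_span_range_iff_exists_fun _).1 hs
  refine ⟨fun q => π (n - e q) (unop (c q)), fun q => h1 _ _, ?_⟩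
  have hl : ∑ q, h q * unop (c q) = v := by
    rw [← hc]
    simp [MulOpposite.smul_eq_mul_unop]
  have := congrArg (π n) hl
  rw [h2 _ _ hv, map_sum] at this
  rw [← this]
  refine Finset.sum_congr rfl fun q _ => ?_
  rw [← h3 _ _ _ (hh q)]
  congr 2
  ring

/-- change of presentation -/
theorem change_pres (hconn : IsConnAlg k R 𝒜) (D : ℕ) {T M L Q : Type} [Fintype T] [Fintype M]
    [Fintype L] [Fintype Q] [DecidableEq L]
    (x : T → R) (dx : T → ℕ) (hdx : ∀ i, dx i ≤ D) (hx : ∀ i, x i ∈ 𝒜 (dx i))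
    (r : M → T → R) (e : M → ℤ) (he : ∀ j, e j ≤ D)
    (hr : ∀ j i, r j i ∈ grZ k R 𝒜 (e j - dx i))
    (hr0 : ∀ j, ∑ i, x i * r j i = 0)
    (hrs : ∀ v : T → R, ∑ i, x i * v i = 0 → v ∈ Submodule.span Rᵐᵒᵖ (Set.range r))
    (y : L → R) (d : L → ℕ) (hd : ∀ l, d l ≤ D) (hy : ∀ l, y l ∈ grZ k R 𝒜 (d l))
    (hy1 : ∀ l, y l ∈ Submodule.span Rᵐᵒᵖ (Set.range x))
    (hy2 : ∀ n ≤ D, ∀ z ∈ grZ k R 𝒜 (n : ℤ), z ∈ Submodule.span Rᵐᵒᵖ (Set.range x) →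
      ∃ b : L → k, (∀ l, d l ≠ n → b l = 0) ∧ ∑ l, b l • y l = z)
    (h : Q → L → R)
    (hh2 : ∀ n ≤ D, ∀ v : L → R, (∀ l, v l ∈ grZ k R 𝒜 ((n : ℤ) - d l)) →
      ∑ l, y l * v l = 0 → v ∈ Submodule.span Rᵐᵒᵖ (Set.range h)) :
    Submodule.span Rᵐᵒᵖ (Set.range x) = Submodule.span Rᵐᵒᵖ (Set.range y) ∧
    ∀ v : L → R, ∑ l, y l * v l = 0 → v ∈ Submodule.span Rᵐᵒᵖ (Set.range h) := by
  have hxz : ∀ i, x i ∈ grZ k R 𝒜 (dx i : ℤ) := fun i => by rw [grZ_nat]; exact hx i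
  have hb : ∀ i, ∃ b : L → k, (∀ l, d l ≠ dx i → b l = 0) ∧ ∑ l, b l • y l = x i := fun i =>
    hy2 _ (hdx i) _ (hxz i) (Submodule.subset_span ⟨i, rfl⟩)
  choose b hb0 hb1 using hb
  have hc := fun l => homog_comb hconn x (fun i => (dx i : ℤ)) hxz (d l) (y l) (hy l) (hy1 l)
  choose c hc0 hc1 using hc
  let B : T → L → R := fun i l => b i l • (1 : R)
  have hB : ∀ i l, B i l ∈ grZ k R 𝒜 ((dx i : ℤ) - d l) := by
    intro i l
    by_cases hdl : d l = dx i
    · rw [hdl, sub_self]; exact grZ_smul_one hconn _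
    · simp [B, hb0 i l hdl]
  have hB1 : ∀ i, ∑ l, y l * B i l = x i := by
    intro i; rw [← hb1 i]; simp [B]
  constructor
  · apply le_antisymm
    · rw [Submodule.span_le]
      rintro _ ⟨i, rfl⟩
      refine (Submodule.mem_span_range_iff_exists_fun _).2 ⟨fun l => op (B i l), ?_⟩
      simpa using hB1 i
    · rw [Submodule.span_le]
      rintro _ ⟨l, rfl⟩
      exact hy1 l
  -- extended to integer degrees
  have hh3 : ∀ n : ℤ, n ≤ D → ∀ v : L → R, (∀ l, v l ∈ grZ k R 𝒜 (n - d l)) →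
      ∑ l, y l * v l = 0 → v ∈ Submodule.span Rᵐᵒᵖ (Set.range h) := by
    intro n hn v hv h0
    rcases lt_or_ge n 0 with hn0 | hn0
    · have : v = 0 := by
        funext l
        have := hv l
        rw [grZ_neg (by omega), Submodule.mem_bot] at this
        exact this
      rw [this]; exact Submodule.zero_mem _
    · lift n to ℕ using hn0
      exact hh2 n (by omega) v hv h0
  intro v hv
  let u : T → R := fun i => ∑ l, c l i * v l
  have hu : ∑ i, x i * u i = 0 := by
    simp only [u, Finset.mul_sum]
    rw [Finset.sum_comm, ← hv]
    refine Finset.sum_congr rfl fun l _ => ?_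
    rw [← hc1 l, Finset.sum_mul]
    simp only [mul_assoc]
  -- the basic relations in degree `d l`
  let g : L → L → R := fun l l' => (if l' = l then 1 else 0) - ∑ i, B i l' * c l i
  have hg : ∀ l, g l ∈ Submodule.span Rᵐᵒᵖ (Set.range h) := by
    intro l
    refine hh3 (d l) (by exact_mod_cast hd l) _ (fun l' => ?_) ?_
    · refine Submodule.sub_mem _ ?_ (Submodule.sum_mem _ fun i _ => ?_)
      · split_ifs with hl
        · subst hl
          rw [sub_self]
          have := grZ_smul_one hconn (1 : k)
          rwa [one_smul] at this
        · exact Submodule.zero_mem _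
      · exact grZ_mul hconn (by ring) (hB i l') (hc0 l i)
    · simp only [g, mul_sub, Finset.sum_sub_distrib, Finset.mul_sum]
      rw [Finset.sum_comm]
      simp only [← mul_assoc, ← Finset.sum_mul, hB1, hc1]
      simp
  have hBr : ∀ j, (fun l => ∑ i, B i l * r j i) ∈ Submodule.span Rᵐᵒᵖ (Set.range h) := by
    intro j
    refine hh3 (e j) (he j) _ (fun l => Submodule.sum_mem _ fun i _ => ?_) ?_
    · exact grZ_mul hconn (by ring) (hB i l) (hr j i)
    · simp only [Finset.mul_sum]
      rw [Finset.sum_comm]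
      simp only [← mul_assoc, ← Finset.sum_mul, hB1, hr0]
  obtain ⟨a, ha⟩ := (Submodule.mem_span_range_iff_exists_fun _).1 (hrs u hu)
  have key : v = ∑ l, op (v l) • g l + ∑ j, a j • (fun l => ∑ i, B i l * r j i) := by
    funext l'
    have e1 : (∑ j, a j • (fun l => ∑ i, B i l * r j i)) l' = ∑ i, B i l' * u i := by
      rw [← ha]
      simp only [Finset.sum_apply, Pi.smul_apply, MulOpposite.smul_eq_mul_unop, Finset.mul_sum,
        Finset.sum_mul, mul_assoc]
      rw [Finset.sum_comm]
    rw [Pi.add_apply, e1]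
    simp only [Finset.sum_apply, Pi.smul_apply, MulOpposite.smul_eq_mul_unop, unop_op, g, u,
      sub_mul, Finset.sum_sub_distrib, Finset.mul_sum, Finset.sum_mul, ite_mul, one_mul, zero_mul,
      Finset.sum_ite_eq, Finset.mem_univ, if_true, mul_assoc]
    rw [Finset.sum_comm (f := fun l i => B i l' * (c l i * v l))]
    simp
  rw [key]
  exact Submodule.add_mem _ (Submodule.sum_mem _ fun l _ => Submodule.smul_mem _ _ (hg l))
    (Submodule.sum_mem _ fun j _ => Submodule.smul_mem _ _ (hBr j))

/-- evaluation map `(y, h), v ↦ ∑ y l * v l` in degree `n`. -/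
noncomputable def phiMap (hconn : IsConnAlg k R 𝒜) {L Q : Type} [Fintype L] [Fintype Q]
    (d : L → ℤ) (e : Q → ℤ) (n : ℤ) :
    ((∀ l, grZ k R 𝒜 (d l)) × (∀ q l, grZ k R 𝒜 (e q - d l))) →ₗ[k]
      (∀ l, grZ k R 𝒜 (n - d l)) →ₗ[k] grZ k R 𝒜 n :=
  LinearMap.mk₂ k (fun w v => ⟨∑ l, (w.1 l : R) * v l, Submodule.sum_mem _ fun l _ =>
      grZ_mul hconn (by ring) (w.1 l).2 (v l).2⟩)
    (fun w w' v => Subtype.ext (by simp [add_mul, Finset.sum_add_distrib]))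
    (fun c w v => Subtype.ext (by simp [Finset.smul_sum]))
    (fun w v v' => Subtype.ext (by simp [mul_add, Finset.sum_add_distrib]))
    (fun c w v => Subtype.ext (by simp [Finset.smul_sum]))

/-- the map `(y, h), a ↦ ∑ h q * a q` in degree `n`. -/
noncomputable def psiMap (hconn : IsConnAlg k R 𝒜) {L Q : Type} [Fintype L] [Fintype Q]
    (d : L → ℤ) (e : Q → ℤ) (n : ℤ) :
    ((∀ l, grZ k R 𝒜 (d l)) × (∀ q l, grZ k R 𝒜 (e q - d l))) →ₗ[k]
      (∀ q, grZ k R 𝒜 (n - e q)) →ₗ[k] (∀ l, grZ k R 𝒜 (n - d l)) :=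
  LinearMap.mk₂ k (fun w a l => ⟨∑ q, (w.2 q l : R) * a q, Submodule.sum_mem _ fun q _ =>
      grZ_mul hconn (by ring) (w.2 q l).2 (a q).2⟩)
    (fun w w' v => funext fun l => Subtype.ext (by simp [add_mul, Finset.sum_add_distrib]))
    (fun c w v => funext fun l => Subtype.ext (by simp [Finset.smul_sum]))
    (fun w v v' => funext fun l => Subtype.ext (by simp [mul_add, Finset.sum_add_distrib]))
    (fun c w v => funext fun l => Subtype.ext (by simp [Finset.smul_sum]))

theorem phiMap_coe (hconn : IsConnAlg k R 𝒜) {L Q : Type} [Fintype L] [Fintype Q]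
    (d : L → ℤ) (e : Q → ℤ) (n : ℤ) (w) (v : ∀ l, grZ k R 𝒜 (n - d l)) :
    (phiMap (Q := Q) hconn d e n w v : R) = ∑ l, (w.1 l : R) * v l := rfl

theorem psiMap_coe (hconn : IsConnAlg k R 𝒜) {L Q : Type} [Fintype L] [Fintype Q]
    (d : L → ℤ) (e : Q → ℤ) (n : ℤ) (w) (a : ∀ q, grZ k R 𝒜 (n - e q)) (l : L) :
    (psiMap hconn d e n w a l : R) = ∑ q, (w.2 q l : R) * a q := rfl

end graded

/-- over a connected algebra with an exact sequence
`F₃ → F₂ → F₁ → A → k_A → 0` of finite graded free modules, the set of Hilbert series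
of right ideals with generators and relations in degrees at most `D` is finite. -/
theorem statement_2 (k R : Type) [Field k] [Ring R] [Algebra k R]
    (𝒜 : ℕ → Submodule k R) (hconn : IsConnAlg k R 𝒜) (hlf : LocFin k R 𝒜)
    (hfp3 : AlgFinPres3 k R 𝒜) (D : ℕ) (hD : 0 < D) :
    {hh : ℕ → ℕ | ∃ I : Submodule Rᵐᵒᵖ R,
      (∃ (t : ℕ) (x : Fin t → R) (dx : Fin t → ℕ),
        (∀ i, dx i ≤ D) ∧ (∀ i, x i ∈ 𝒜 (dx i)) ∧
        Submodule.span Rᵐᵒᵖ (Set.range x) = I ∧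
        ∃ (m : ℕ) (hrel : Fin m → (Fin t → R)) (e : Fin m → ℤ),
          (∀ j, e j ≤ (D : ℤ)) ∧
          (∀ j, FreeHomog k R 𝒜 (fun i => (dx i : ℤ)) (hrel j) (e j)) ∧
          SolSpanBy R R x hrel) ∧
      hh = hilbI k R 𝒜 I}.Finite := by
  classical
  have hfin := grZ_fin hlf
  let L := Σ n : Fin (D + 1), Fin (Module.finrank k (grZ k R 𝒜 ((n : ℕ) : ℤ)))
  let d : L → ℕ := fun l => l.1
  let Q := Σ n : Fin (D + 1),
    Fin (Module.finrank k (∀ l : L, grZ k R 𝒜 (((n : ℕ) : ℤ) - (d l : ℤ))))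
  let e : Q → ℕ := fun q => q.1
  let dz : L → ℤ := fun l => (d l : ℤ)
  let ez : Q → ℤ := fun q => (e q : ℤ)
  refine (lin_finite (fun n : ℕ => grZ k R 𝒜 (n : ℤ)) (fun n : ℕ => ∀ l, grZ k R 𝒜 ((n : ℤ) - dz l))
    (fun n : ℕ => ∀ q, grZ k R 𝒜 ((n : ℤ) - ez q))
    (fun n => phiMap hconn dz ez n) (fun n => psiMap hconn dz ez n)).subset ?_
  rintro _ ⟨I, ⟨t, x, dx, hdx, hx, hI, m, r, e', he', hr, hr0, hrs⟩, rfl⟩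
  subst hI
  set I := Submodule.span Rᵐᵒᵖ (Set.range x) with hIdef
  have hxs : ∀ v : Fin t → R, IsSol R R x v ↔ ∑ i, x i * v i = 0 := fun v => by
    simp [IsSol]
  -- the generators
  have hY := fun n : Fin (D + 1) => exists_span_fam
    ((I.restrictScalars k).comap (grZ k R 𝒜 ((n : ℕ) : ℤ)).subtype)
  choose Y hY using hY
  let y : ∀ l : L, grZ k R 𝒜 (dz l) := fun l => Y l.1 l.2
  -- the relations
  let κ : ∀ n : ℤ, (∀ l, grZ k R 𝒜 (n - dz l)) →ₗ[k] grZ k R 𝒜 n := fun n =>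
    phiMap (Q := Q) hconn dz ez n (y, 0)
  have hH := fun n : Fin (D + 1) => exists_span_fam (LinearMap.ker (κ ((n : ℕ) : ℤ)))
  choose H hH using hH
  let h : ∀ (q : Q) (l : L), grZ k R 𝒜 (ez q - dz l) := fun q => H q.1 q.2
  have hy1 : ∀ l, (y l : R) ∈ I := by
    intro l
    have : Y l.1 l.2 ∈ Submodule.span k (Set.range (Y l.1)) := Submodule.subset_span ⟨l.2, rfl⟩
    rw [hY] at this
    exact this
  have hy2 : ∀ n ≤ D, ∀ z ∈ grZ k R 𝒜 (n : ℤ), z ∈ I →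
      ∃ b : L → k, (∀ l, d l ≠ n → b l = 0) ∧ ∑ l, b l • (y l : R) = z := by
    intro n hn z hz hzI
    let n' : Fin (D + 1) := ⟨n, by omega⟩
    have hz' : (⟨z, hz⟩ : grZ k R 𝒜 ((n' : ℕ) : ℤ)) ∈ Submodule.span k (Set.range (Y n')) := by
      rw [hY]; exact hzI
    obtain ⟨c, hc⟩ := (Submodule.mem_span_range_iff_exists_fun _).1 hz'
    refine ⟨fun l => if hl : l.1 = n' then c (hl ▸ l.2) else 0, ?_, ?_⟩
    · intro l hl
      have : l.1 ≠ n' := fun h' => hl (congrArg Fin.val h')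
      simp [this]
    · have : ((∑ i, c i • Y n' i : grZ k R 𝒜 ((n' : ℕ) : ℤ)) : R) = z := congrArg Subtype.val hc
      rw [← this, Fintype.sum_sigma, Finset.sum_eq_single n']
      · simp [y]
      · intro b _ hb
        simp [hb]
      · simp
  have hh1 : ∀ q, ∑ l, (y l : R) * h q l = 0 := by
    intro q
    have : H q.1 q.2 ∈ Submodule.span k (Set.range (H q.1)) := Submodule.subset_span ⟨q.2, rfl⟩
    rw [hH, LinearMap.mem_ker] at this
    exact congrArg Subtype.val this
  have hh2 : ∀ n ≤ D, ∀ v : L → R, (∀ l, v l ∈ grZ k R 𝒜 ((n : ℤ) - d l)) →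
      ∑ l, (y l : R) * v l = 0 →
      v ∈ Submodule.span Rᵐᵒᵖ (Set.range fun q l => (h q l : R)) := by
    intro n hn v hv h0
    let n' : Fin (D + 1) := ⟨n, by omega⟩
    let v' : ∀ l, grZ k R 𝒜 (((n' : ℕ) : ℤ) - dz l) := fun l => ⟨v l, hv l⟩
    have hv' : v' ∈ Submodule.span k (Set.range (H n')) := by
      rw [hH, LinearMap.mem_ker]
      exact Subtype.ext h0
    obtain ⟨c, hc⟩ := (Submodule.mem_span_range_iff_exists_fun _).1 hv'
    have : v = ∑ i, op (c i • (1 : R)) • (fun l => (H n' i l : R)) := by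
      funext l
      have := congrArg Subtype.val (congrFun hc l)
      simp only [Finset.sum_apply, Pi.smul_apply, AddSubmonoidClass.coe_finsetSum,
        Submodule.coe_smul] at this
      change _ = v l at this
      rw [← this]
      simp
    rw [this]
    exact Submodule.sum_mem _ fun i _ => Submodule.smul_mem _ _
      (Submodule.subset_span ⟨⟨n', i⟩, rfl⟩)
  obtain ⟨C1, C2⟩ := change_pres hconn D x dx hdx hx r e' he' hr (fun j => (hxs _).1 (hr0 j))
    (fun v hv => hrs v ((hxs v).2 hv)) (fun l => (y l : R)) d
    (fun l => Nat.lt_succ_iff.1 l.1.2) (fun l => (y l).2) hy1 hy2 (fun q l => (h q l : R)) hh2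
  refine ⟨(y, h), fun n => ?_, funext fun n => ?_⟩
  · apply le_antisymm
    · rintro _ ⟨a, rfl⟩
      rw [LinearMap.mem_ker]
      apply Subtype.ext
      rw [phiMap_coe]
      simp only [psiMap_coe, Finset.mul_sum]
      rw [Finset.sum_comm]
      simp only [← mul_assoc, ← Finset.sum_mul, hh1]
      simp
    · intro v hv
      have hv0 : ∑ l, (y l : R) * v l = 0 := congrArg Subtype.val (LinearMap.mem_ker.1 hv)
      obtain ⟨a, ha, ha2⟩ := homog_comb_mod hconn (fun q l => (h q l : R)) dz ez
        (fun q l => (h q l).2) n (fun l => (v l : R)) (fun l => (v l).2) (C2 _ hv0)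
      exact ⟨fun q => ⟨a q, ha q⟩, funext fun l => Subtype.ext (ha2 l)⟩
  · have : (LinearMap.range (phiMap hconn dz ez (n : ℤ) (y, h))).map
        (grZ k R 𝒜 (n : ℤ)).subtype = 𝒜 n ⊓ I.restrictScalars k := by
      ext z
      constructor
      · rintro ⟨_, ⟨v, rfl⟩, rfl⟩
        refine ⟨?_, ?_⟩
        · have := (phiMap hconn dz ez (n : ℤ) (y, h) v).2
          exact (grZ_nat (𝒜 := 𝒜) n).le this
        · change (phiMap hconn dz ez (n : ℤ) (y, h) v : R) ∈ I
          rw [phiMap_coe]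
          refine Submodule.sum_mem _ fun l _ => ?_
          have := I.smul_mem (op (v l : R)) (hy1 l)
          simpa using this
      · rintro ⟨hz, hzI⟩
        have hz' : z ∈ grZ k R 𝒜 (n : ℤ) := by rw [grZ_nat]; exact hz
        have hzI' : z ∈ I := hzI
        rw [hIdef, C1] at hzI'
        obtain ⟨a, ha, ha2⟩ := homog_comb hconn (fun l => (y l : R)) dz (fun l => (y l).2) n z hz' hzI'
        exact ⟨⟨z, hz'⟩, ⟨fun l => ⟨a l, ha l⟩, Subtype.ext ha2⟩, rfl⟩
    change Module.finrank k ↥(𝒜 n ⊓ I.restrictScalars k) = _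
    rw [← this]
    exact (LinearEquiv.finrank_eq (Submodule.equivMapOfInjective _
      (Submodule.subtype_injective _) _)).symm

end NCG
end
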